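/- Let p, q be positive integers. The total number of partitions in NC^B(p,q) equals ((p+q+pq)/(p+q)) · C(2p, p) · C(2q, q). -/

import Mathlib

/-!  Common setup: annular non-crossing partitions of type B, following
Goulden–Nica–Oancea, "Enumerative properties of NC^(B)(p,q)". -/

/-- The underlying set `{±1, …, ±n}`, realized inside `ℤ`. -/
def signedSet (n : ℕ) : Set ℤ := {x : ℤ | x ≠ 0 ∧ |x| ≤ (n : ℤ)}

/-- Membership in the hyperoctahedral group `B_n`, realized as the permutations of `ℤ`
that commute with negation and fix every point outside `{±1, …, ±n}`. -/
def inB (n : ℕ) (π : Equiv.Perm ℤ) : Prop :=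
  (∀ x : ℤ, π (-x) = -(π x)) ∧ ∀ x : ℤ, x ∉ signedSet n → π x = x

/-- The set of generators of `B_n`:
`(i,j)(-i,-j)`, `(i,-j)(-i,j)` for `1 ≤ i ≠ j ≤ n`, and `(i,-i)` for `1 ≤ i ≤ n`. -/
def genB (n : ℕ) : Set (Equiv.Perm ℤ) :=
  {π | (∃ i j : ℤ, 1 ≤ i ∧ i ≤ (n : ℤ) ∧ 1 ≤ j ∧ j ≤ (n : ℤ) ∧ i ≠ j ∧
          π = Equiv.swap i j * Equiv.swap (-i) (-j)) ∨
       (∃ i j : ℤ, 1 ≤ i ∧ i ≤ (n : ℤ) ∧ 1 ≤ j ∧ j ≤ (n : ℤ) ∧ i ≠ j ∧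
          π = Equiv.swap i (-j) * Equiv.swap (-i) j) ∨
       (∃ i : ℤ, 1 ≤ i ∧ i ≤ (n : ℤ) ∧ π = Equiv.swap i (-i))}

/-- The length function `ℓ_B` on `B_n`: the least `k` such that `τ` is a product of `k`
generators from `genB n` (the empty product being the identity). -/
noncomputable def lenB (n : ℕ) (τ : Equiv.Perm ℤ) : ℕ :=
  sInf {k : ℕ | ∃ l : List (Equiv.Perm ℤ),
    l.length = k ∧ (∀ g ∈ l, g ∈ genB n) ∧ l.prod = τ}

/-- The partial order on `B_n`:  `τ ≤ σ` iff `ℓ_B(σ) = ℓ_B(τ) + ℓ_B(τ⁻¹σ)`. -/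
def leB (n : ℕ) (τ σ : Equiv.Perm ℤ) : Prop :=
  lenB n σ = lenB n τ + lenB n (τ⁻¹ * σ)

/-- The permutation `γ_{p,q} = (1,…,p,-1,…,-p)(p+1,…,p+q,-(p+1),…,-(p+q))`. -/
def gammaPQ (p q : ℕ) : Equiv.Perm ℤ :=
  (((List.range p).map fun i => ((i : ℤ) + 1)) ++
      ((List.range p).map fun i => -((i : ℤ) + 1))).formPerm *
    (((List.range q).map fun i => ((p : ℤ) + (i : ℤ) + 1)) ++
      ((List.range q).map fun i => -((p : ℤ) + (i : ℤ) + 1))).formPerm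

/-- The long cycle `γ_n = (1,…,n,-1,…,-n)` of `B_n` (disc case). -/
def gammaDisc (n : ℕ) : Equiv.Perm ℤ :=
  (((List.range n).map fun i => ((i : ℤ) + 1)) ++
    ((List.range n).map fun i => -((i : ℤ) + 1))).formPerm

/-- The annular non-crossing permutations of type B: `S^B_nc(p,q) = [ε, γ_{p,q}] ⊆ B_{p+q}`. -/
def SncB (p q : ℕ) : Set (Equiv.Perm ℤ) :=
  {τ | inB (p + q) τ ∧ leB (p + q) τ (gammaPQ p q)}

/-- The orbit of `x` under the permutation `τ`. -/
def permOrbit (τ : Equiv.Perm ℤ) (x : ℤ) : Set ℤ := {y | ∃ m : ℤ, (τ ^ m) x = y}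

/-- The partition `Ω(τ)` of `{±1,…,±n}` into orbits of `τ`. -/
def orbitsOn (n : ℕ) (τ : Equiv.Perm ℤ) : Set (Set ℤ) :=
  {A | ∃ x ∈ signedSet n, A = permOrbit τ x}

/-- The negation `-A` of a set `A ⊆ ℤ`. -/
def negSet (A : Set ℤ) : Set ℤ := {x | -x ∈ A}

/-- The partition `Ω̃(τ)`, obtained from `Ω(τ)` by merging all inversion-invariant orbits
(orbits `A` with `A = -A`) into a single block. -/
def omegaTilde (n : ℕ) (τ : Equiv.Perm ℤ) : Set (Set ℤ) :=
  {A | A ∈ orbitsOn n τ ∧ negSet A ≠ A} ∪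
    {B | B = ⋃₀ {A | A ∈ orbitsOn n τ ∧ negSet A = A} ∧ B.Nonempty}

/-- The annular non-crossing partitions of type B: `NC^B(p,q) = {Ω̃(τ) : τ ∈ S^B_nc(p,q)}`. -/
def NCB (p q : ℕ) : Set (Set (Set ℤ)) :=
  {π | ∃ τ ∈ SncB p q, π = omegaTilde (p + q) τ}

/-- The type B non-crossing partitions of the disc: `NC^B(n) = {Ω̃(τ) : τ ∈ B_n, τ ≤ γ_n}`. -/
def NCBdisc (n : ℕ) : Set (Set (Set ℤ)) :=
  {π | ∃ τ, inB n τ ∧ leB n τ (gammaDisc n) ∧ π = omegaTilde n τ}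

/-- Reverse refinement order on partitions: every block of `π` is contained in a block of `ρ`. -/
def refines (π ρ : Set (Set ℤ)) : Prop := ∀ A ∈ π, ∃ B ∈ ρ, A ⊆ B

/-- The rank of a partition of `{±1,…,±n}`:
`n` minus half the number of blocks `A` with `A ≠ -A`. -/
noncomputable def rankNCB (n : ℕ) (π : Set (Set ℤ)) : ℕ :=
  n - {A | A ∈ π ∧ negSet A ≠ A}.ncard / 2

/-- The inner point set `{±(p+1), …, ±(p+q)}`. -/
def innerSet (p q : ℕ) : Set ℤ := {x : ℤ | (p : ℤ) < |x| ∧ |x| ≤ (p : ℤ) + (q : ℤ)}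

/-- The connectivity of `π ∈ NC^B(p,q)`: half the number of blocks `A` with `A ≠ -A`
meeting both `{±1,…,±p}` and `{±(p+1),…,±(p+q)}`. -/
noncomputable def connectivity (p q : ℕ) (π : Set (Set ℤ)) : ℕ :=
  {A | A ∈ π ∧ negSet A ≠ A ∧ (A ∩ signedSet p).Nonempty ∧
    (A ∩ innerSet p q).Nonempty}.ncard / 2

/-- The number of exterior pairs of blocks `{A, -A}` (with `A ≠ -A`, `A ⊆ {±1,…,±p}`). -/
noncomputable def extPairs (p : ℕ) (π : Set (Set ℤ)) : ℕ :=
  {A | A ∈ π ∧ negSet A ≠ A ∧ A ⊆ signedSet p}.ncard / 2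

/-- The number of interior pairs of blocks `{A, -A}`
(with `A ≠ -A`, `A ⊆ {±(p+1),…,±(p+q)}`). -/
noncomputable def intPairs (p q : ℕ) (π : Set (Set ℤ)) : ℕ :=
  {A | A ∈ π ∧ negSet A ≠ A ∧ A ⊆ innerSet p q}.ncard / 2

/-- The minimum `0̂` of `NC^B(p,q)` (with `n = p+q`): the partition into singletons. -/
def botNCB (n : ℕ) : Set (Set ℤ) := {A | ∃ x ∈ signedSet n, A = {x}}

/-- The maximum `1̂` of `NC^B(p,q)` (with `n = p+q`): the partition with a single block. -/
def topNCB (n : ℕ) : Set (Set ℤ) := {signedSet n}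

/-- The orbit of `x` under the subgroup generated by `{τ, γ}`. -/
def jointOrbit (τ γ : Equiv.Perm ℤ) (x : ℤ) : Set ℤ :=
  {y | ∃ g ∈ Subgroup.closure ({τ, γ} : Set (Equiv.Perm ℤ)), g x = y}

/-- The orbits on `{±1,…,±n}` of the subgroup generated by `{τ, γ}`. -/
def jointOrbitsOn (n : ℕ) (τ γ : Equiv.Perm ℤ) : Set (Set ℤ) :=
  {Y | ∃ x ∈ signedSet n, Y = jointOrbit τ γ x}


/-! ### Linear algebra model of the length function -/

def VV (n : ℕ) : Submodule ℚ (ℤ → ℚ) where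
  carrier := {v | (∀ x, v (-x) = - v x) ∧ ∀ x, x ∉ signedSet n → v x = 0}
  add_mem' := by
    rintro a b ⟨h1, h2⟩ ⟨h3, h4⟩
    refine ⟨fun x => ?_, fun x hx => ?_⟩
    · simp [h1, h3]; ring
    · simp [h2 x hx, h4 x hx]
  zero_mem' := by simp
  smul_mem' := by
    rintro c a ⟨h1, h2⟩
    refine ⟨fun x => ?_, fun x hx => ?_⟩
    · simp [h1]
    · simp [h2 x hx]

def FF (n : ℕ) (τ : Equiv.Perm ℤ) : Submodule ℚ (ℤ → ℚ) where
  carrier := {v | v ∈ VV n ∧ ∀ x, v (τ x) = v x}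
  add_mem' := by
    rintro a b ⟨h1, h2⟩ ⟨h3, h4⟩
    exact ⟨(VV n).add_mem h1 h3, fun x => by simp [h2, h4]⟩
  zero_mem' := ⟨(VV n).zero_mem, by simp⟩
  smul_mem' := by
    rintro c a ⟨h1, h2⟩
    exact ⟨(VV n).smul_mem c h1, fun x => by simp [h2]⟩

lemma mem_VV {n : ℕ} {v : ℤ → ℚ} :
    v ∈ VV n ↔ (∀ x, v (-x) = - v x) ∧ ∀ x, x ∉ signedSet n → v x = 0 := Iff.rfl

lemma mem_FF {n : ℕ} {τ : Equiv.Perm ℤ} {v : ℤ → ℚ} :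
    v ∈ FF n τ ↔ v ∈ VV n ∧ ∀ x, v (τ x) = v x := Iff.rfl

lemma FF_le_VV (n : ℕ) (τ : Equiv.Perm ℤ) : FF n τ ≤ VV n := fun _ h => h.1

lemma mem_signedSet {n : ℕ} {x : ℤ} : x ∈ signedSet n ↔ x ≠ 0 ∧ |x| ≤ (n : ℤ) := Iff.rfl

lemma neg_mem_signedSet {n : ℕ} {x : ℤ} : -x ∈ signedSet n ↔ x ∈ signedSet n := by
  simp [mem_signedSet]

lemma signedSet_ne_neg {n : ℕ} {x : ℤ} (h : x ∈ signedSet n) : x ≠ -x := by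
  have := h.1
  omega

lemma signedSet_sub_Icc {n : ℕ} {x : ℤ} (h : x ∈ signedSet n) :
    x ∈ Finset.Icc (-(n : ℤ)) n := by
  have := h.2
  rw [abs_le] at this
  simpa using this

lemma signedSet_finite (n : ℕ) : (signedSet n).Finite :=
  (Finset.finite_toSet (Finset.Icc (-(n : ℤ)) n)).subset fun _ h => signedSet_sub_Icc h

instance VV_fd (n : ℕ) : FiniteDimensional ℚ (VV n) := by
  let f : VV n →ₗ[ℚ] (Finset.Icc (-(n : ℤ)) n → ℚ) :=
    { toFun := fun v i => v.1 i.1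
      map_add' := fun _ _ => rfl
      map_smul' := fun _ _ => rfl }
  refine FiniteDimensional.of_injective f ?_
  intro u v h
  ext x
  by_cases hx : x ∈ signedSet n
  · exact congrFun h ⟨x, signedSet_sub_Icc hx⟩
  · rw [u.2.2 x hx, v.2.2 x hx]

instance FF_fd (n : ℕ) (τ : Equiv.Perm ℤ) : FiniteDimensional ℚ (FF n τ) :=
  Submodule.finiteDimensional_of_le (FF_le_VV n τ)

noncomputable def ell (n : ℕ) (τ : Equiv.Perm ℤ) : ℕ :=
  Module.finrank ℚ (VV n) - Module.finrank ℚ (FF n τ)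

lemma ell_add (n : ℕ) (τ : Equiv.Perm ℤ) :
    ell n τ + Module.finrank ℚ (FF n τ) = Module.finrank ℚ (VV n) := by
  have := Submodule.finrank_mono (FF_le_VV n τ)
  unfold ell; omega

lemma codim1 (S T : Submodule ℚ (ℤ → ℚ)) [FiniteDimensional ℚ S] [FiniteDimensional ℚ T]
    (φ : (ℤ → ℚ) →ₗ[ℚ] ℚ) (h : ∀ v ∈ S, φ v = 0 → v ∈ T) :
    Module.finrank ℚ S ≤ Module.finrank ℚ T + 1 := by
  have h1 := LinearMap.finrank_range_add_finrank_ker (φ.domRestrict S)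
  have h2 : Module.finrank ℚ (LinearMap.range (φ.domRestrict S)) ≤ 1 := by
    have := Submodule.finrank_le (LinearMap.range (φ.domRestrict S))
    simpa using this
  have h3 : Module.finrank ℚ (LinearMap.ker (φ.domRestrict S)) ≤ Module.finrank ℚ T := by
    let g : LinearMap.ker (φ.domRestrict S) →ₗ[ℚ] T :=
      { toFun := fun v => ⟨v.1.1, h _ v.1.2 v.2⟩
        map_add' := fun _ _ => rfl
        map_smul' := fun _ _ => rfl }
    apply LinearMap.finrank_le_finrank_of_injective (f := g)
    intro a b hab
    apply Subtype.ext
    apply Subtype.ext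
    exact congrArg (fun z : T => z.1) hab
  omega

/-! ### basic facts on B_n -/

lemma inB_one (n : ℕ) : inB n 1 := ⟨fun _ => rfl, fun _ _ => rfl⟩

lemma inB_mul {n : ℕ} {a b : Equiv.Perm ℤ} (ha : inB n a) (hb : inB n b) : inB n (a * b) :=
  ⟨fun x => by simp [ha.1, hb.1], fun x hx => by simp [hb.2 x hx, ha.2 x hx]⟩

lemma inB_inv {n : ℕ} {a : Equiv.Perm ℤ} (ha : inB n a) : inB n a⁻¹ := by
  refine ⟨fun x => ?_, fun x hx => ?_⟩
  · rw [Equiv.Perm.inv_eq_iff_eq, ha.1]; simp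
  · rw [Equiv.Perm.inv_eq_iff_eq, ha.2 x hx]

lemma inB_mem {n : ℕ} {a : Equiv.Perm ℤ} (ha : inB n a) {x : ℤ} (hx : x ∈ signedSet n) :
    a x ∈ signedSet n := by
  by_contra h
  have := ha.2 _ h
  have := a.injective this
  rw [this] at h
  exact h hx

def refl' (x y : ℤ) : Equiv.Perm ℤ :=
  if y = x then 1 else if y = -x then Equiv.swap x (-x) else
    Equiv.swap x y * Equiv.swap (-x) (-y)

lemma refl_self (x : ℤ) : refl' x x = 1 := by simp [refl']

lemma refl_left {n : ℕ} {x y : ℤ} (hx : x ∈ signedSet n) (hy : y ∈ signedSet n) :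
    refl' x y x = y := by
  have := hx.1
  have := hy.1
  unfold refl'
  split_ifs with h1 h2
  · simp [h1]
  · simp [h2]
  · rw [Equiv.Perm.mul_apply, Equiv.swap_apply_of_ne_of_ne (a := -x), Equiv.swap_apply_left]
    all_goals omega

lemma refl_right {n : ℕ} {x y : ℤ} (hx : x ∈ signedSet n) (hy : y ∈ signedSet n) :
    refl' x y y = x := by
  have := hx.1
  have := hy.1
  unfold refl'
  split_ifs with h1 h2
  · simp [h1]
  · simp [h2]
  · rw [Equiv.Perm.mul_apply, Equiv.swap_apply_of_ne_of_ne (a := -x), Equiv.swap_apply_right]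
    all_goals omega

lemma refl_other {x y z : ℤ} (h1 : z ≠ x) (h2 : z ≠ -x) (h3 : z ≠ y) (h4 : z ≠ -y) :
    refl' x y z = z := by
  unfold refl'
  split_ifs with h1 h2
  · simp
  · rw [Equiv.swap_apply_of_ne_of_ne] <;> assumption
  · rw [Equiv.Perm.mul_apply, Equiv.swap_apply_of_ne_of_ne (a := -x),
      Equiv.swap_apply_of_ne_of_ne] <;> assumption

lemma refl_neg {n : ℕ} {x y : ℤ} (hx : x ∈ signedSet n) (hy : y ∈ signedSet n) (z : ℤ) :
    refl' x y (-z) = - refl' x y z := by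
  have := hx.1
  have := hy.1
  unfold refl'
  split_ifs with h1 h2
  · simp
  · simp only [Equiv.swap_apply_def]
    split_ifs <;> omega
  · simp only [Equiv.Perm.mul_apply, Equiv.swap_apply_def]
    split_ifs <;> omega

lemma refl_inB {n : ℕ} {x y : ℤ} (hx : x ∈ signedSet n) (hy : y ∈ signedSet n) :
    inB n (refl' x y) := by
  refine ⟨refl_neg hx hy, fun z hz => refl_other ?_ ?_ ?_ ?_⟩
  · rintro rfl; exact hz hx
  · rintro rfl; exact hz (neg_mem_signedSet.2 hx)
  · rintro rfl; exact hz hy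
  · rintro rfl; exact hz (neg_mem_signedSet.2 hy)

lemma refl_mul_self {n : ℕ} {x y : ℤ} (hx : x ∈ signedSet n) (hy : y ∈ signedSet n) :
    refl' x y * refl' x y = 1 := by
  ext z
  rw [Equiv.Perm.mul_apply, Equiv.Perm.one_apply]
  by_cases h1 : z = x
  · rw [h1, refl_left hx hy, refl_right hx hy]
  by_cases h2 : z = -x
  · rw [h2, refl_neg hx hy, refl_left hx hy, refl_neg hx hy, refl_right hx hy]
  by_cases h3 : z = y
  · rw [h3, refl_right hx hy, refl_left hx hy]
  by_cases h4 : z = -y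
  · rw [h4, refl_neg hx hy, refl_right hx hy, refl_neg hx hy, refl_left hx hy]
  rw [refl_other h1 h2 h3 h4, refl_other h1 h2 h3 h4]

lemma refl_mul_cancel {n : ℕ} {x y : ℤ} (hx : x ∈ signedSet n) (hy : y ∈ signedSet n)
    (τ : Equiv.Perm ℤ) : refl' x y * (refl' x y * τ) = τ := by
  rw [← mul_assoc, refl_mul_self hx hy, one_mul]

lemma refl_conj {n : ℕ} {τ : Equiv.Perm ℤ} (hτ : inB n τ) (x y : ℤ) :
    τ * refl' x y * τ⁻¹ = refl' (τ x) (τ y) := by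
  have e : (τ y = - τ x) = (y = -x) := by rw [← hτ.1, τ.injective.eq_iff]
  unfold refl'
  simp only [τ.injective.eq_iff, e]
  split_ifs with h1 h2
  · simp
  · rw [← hτ.1, Equiv.swap_apply_apply]
  · rw [← hτ.1, ← hτ.1, Equiv.swap_apply_apply, Equiv.swap_apply_apply]; group

/-- value-level invariance -/
lemma FF_refl {n : ℕ} {x y : ℤ} (hx : x ∈ signedSet n) (hy : y ∈ signedSet n)
    {v : ℤ → ℚ} (hv : v ∈ VV n) (h : v x = v y) (z : ℤ) : v (refl' x y z) = v z := by
  by_cases h1 : z = x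
  · rw [h1, refl_left hx hy, h]
  by_cases h2 : z = -x
  · rw [h2, refl_neg hx hy, refl_left hx hy, hv.1, hv.1, h]
  by_cases h3 : z = y
  · rw [h3, refl_right hx hy, h]
  by_cases h4 : z = -y
  · rw [h4, refl_neg hx hy, refl_right hx hy, hv.1, hv.1, h]
  rw [refl_other h1 h2 h3 h4]

/-- the basis vectors -/
def ee (x : ℤ) : ℤ → ℚ := fun z => if z = x then 1 else if z = -x then -1 else 0

lemma ee_mem {n : ℕ} {x : ℤ} (hx : x ∈ signedSet n) : ee x ∈ VV n := by
  have h0 := hx.1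
  refine ⟨fun z => ?_, fun z hz => ?_⟩
  · unfold ee
    by_cases h1 : z = x
    · subst h1
      rw [if_neg (by omega)]; simp
    · by_cases h2 : z = -x
      · subst h2; simp; rw [if_neg (by omega)]; simp
      · rw [if_neg (by omega), if_neg (by omega), if_neg (by omega), if_neg (by omega)]; simp
  · unfold ee
    rw [if_neg, if_neg]
    · rintro rfl; exact hz (neg_mem_signedSet.2 hx)
    · rintro rfl; exact hz hx

lemma ee_self (x : ℤ) : ee x x = 1 := by simp [ee]

lemma ee_eq_one {x z : ℤ} (h : ee x z = 1) : z = x := by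
  unfold ee at h
  split_ifs at h with h1 h2
  · exact h1
  · norm_num at h
  · norm_num at h

lemma ee_FF_iff {n : ℕ} {τ : Equiv.Perm ℤ} (hτ : inB n τ) {x : ℤ} (hx : x ∈ signedSet n) :
    ee x ∈ FF n τ ↔ τ x = x := by
  constructor
  · intro h
    have := h.2 x
    rw [ee_self] at this
    exact ee_eq_one this
  · intro h
    refine ⟨ee_mem hx, fun z => ?_⟩
    have h' : τ (-x) = -x := by rw [hτ.1, h]
    unfold ee
    have e1 : (τ z = x) = (z = x) := by
      conv_lhs => rw [← h, τ.injective.eq_iff]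
    have e2 : (τ z = -x) = (z = -x) := by
      conv_lhs => rw [← h', τ.injective.eq_iff]
    simp only [e1, e2]

lemma perm_eq_of_VV {n : ℕ} {a b : Equiv.Perm ℤ} (ha : inB n a) (hb : inB n b)
    (h : ∀ v ∈ VV n, ∀ x, v (a x) = v (b x)) : a = b := by
  ext x
  by_cases hx : x ∈ signedSet n
  · have := h (ee (b x)) (ee_mem (inB_mem hb hx)) x
    rw [ee_self] at this
    exact ee_eq_one this
  · rw [ha.2 x hx, hb.2 x hx]

lemma ell_one (n : ℕ) : ell n 1 = 0 := by
  have : FF n 1 = VV n := le_antisymm (FF_le_VV _ _) fun v hv => ⟨hv, fun _ => rfl⟩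
  unfold ell; rw [this]; omega

lemma eq_one_of_ell {n : ℕ} {τ : Equiv.Perm ℤ} (hτ : inB n τ) (h : ell n τ = 0) : τ = 1 := by
  have h1 := ell_add n τ
  have h2 : FF n τ = VV n := Submodule.eq_of_le_of_finrank_eq (FF_le_VV _ _) (by omega)
  refine perm_eq_of_VV hτ (inB_one n) fun v hv x => ?_
  rw [← h2] at hv
  exact hv.2 x

lemma FF_inf_le (n : ℕ) (a b : Equiv.Perm ℤ) : FF n a ⊓ FF n b ≤ FF n (a * b) := by
  rintro v ⟨h1, h2⟩
  exact ⟨h1.1, fun x => by rw [Equiv.Perm.mul_apply, h1.2, h2.2]⟩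

lemma ell_mul_le (n : ℕ) (a b : Equiv.Perm ℤ) : ell n (a * b) ≤ ell n a + ell n b := by
  have h1 := Submodule.finrank_sup_add_finrank_inf_eq (FF n a) (FF n b)
  have h2 := Submodule.finrank_mono (FF_inf_le n a b)
  have h3 := Submodule.finrank_mono (sup_le (FF_le_VV n a) (FF_le_VV n b))
  have h4 := ell_add n a
  have h5 := ell_add n b
  have h6 := ell_add n (a * b)
  omega

/-- if lengths add then the fixed spaces behave -/
lemma FF_of_le {n : ℕ} {a b : Equiv.Perm ℤ} (h : ell n a + ell n b = ell n (a * b)) :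
    FF n (a * b) ≤ FF n a ∧ FF n (a * b) ≤ FF n b ∧ FF n a ⊔ FF n b = VV n := by
  have h1 := Submodule.finrank_sup_add_finrank_inf_eq (FF n a) (FF n b)
  have h2 := Submodule.finrank_mono (FF_inf_le n a b)
  have h3 := Submodule.finrank_mono (sup_le (FF_le_VV n a) (FF_le_VV n b))
  have h4 := ell_add n a
  have h5 := ell_add n b
  have h6 := ell_add n (a * b)
  have e1 : FF n a ⊓ FF n b = FF n (a * b) :=
    Submodule.eq_of_le_of_finrank_eq (FF_inf_le n a b) (by omega)
  have e2 : FF n a ⊔ FF n b = VV n :=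
    Submodule.eq_of_le_of_finrank_eq (sup_le (FF_le_VV n a) (FF_le_VV n b)) (by omega)
  exact ⟨e1 ▸ inf_le_left, e1 ▸ inf_le_right, e2⟩

def phi (x y : ℤ) : (ℤ → ℚ) →ₗ[ℚ] ℚ where
  toFun v := v x - v y
  map_add' a b := by simp; ring
  map_smul' c a := by simp; ring

lemma ell_refl_le {n : ℕ} {x y : ℤ} (hx : x ∈ signedSet n) (hy : y ∈ signedSet n) :
    ell n (refl' x y) ≤ 1 := by
  have h1 := codim1 (VV n) (FF n (refl' x y)) (phi x y) (fun v hv h =>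
    ⟨hv, FF_refl hx hy hv (sub_eq_zero.1 h)⟩)
  unfold ell; omega

/-- L1 -/
lemma ell_delete {n : ℕ} {τ : Equiv.Perm ℤ} (hτ : inB n τ) {x k : ℤ} (hx : x ∈ signedSet n)
    (hk : k ∈ signedSet n) (hfix : τ x = x) :
    ell n (refl' x k * τ) = ell n τ + if k = x then 0 else 1 := by
  split_ifs with h
  · subst h; rw [refl_self, one_mul, add_zero]
  · set δ := refl' x k * τ with hδ
    have hδx : δ x = k := by rw [hδ, Equiv.Perm.mul_apply, hfix, refl_left hx hk]
    have hle : FF n δ ≤ FF n τ := by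
      intro v hv
      refine ⟨hv.1, fun z => ?_⟩
      have h1 : v x = v k := by rw [← hv.2 x, hδx]
      rw [← FF_refl hx hk hv.1 h1, ← Equiv.Perm.mul_apply, ← hδ, hv.2]
    have hlt : FF n δ < FF n τ := by
      refine lt_of_le_of_ne hle fun e => ?_
      have h1 : ee x ∈ FF n τ := (ee_FF_iff hτ hx).2 hfix
      rw [← e, ee_FF_iff (inB_mul (refl_inB hx hk) hτ) hx, hδx] at h1
      exact h h1
    have h1 := Submodule.finrank_lt_finrank_of_lt hlt
    have h2 := codim1 (FF n τ) (FF n δ) (phi x k) (fun v hv h =>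
      ⟨hv.1, fun z => by
        rw [hδ, Equiv.Perm.mul_apply, FF_refl hx hk hv.1 (sub_eq_zero.1 h), hv.2]⟩)
    have h3 := ell_add n δ
    have h4 := ell_add n τ
    omega

lemma ell_delete' {n : ℕ} {τ : Equiv.Perm ℤ} (hτ : inB n τ) {x : ℤ} (hx : x ∈ signedSet n) :
    ell n τ = ell n (refl' x (τ x) * τ) + if τ x = x then 0 else 1 := by
  have hk := inB_mem hτ hx
  have := ell_delete (inB_mul (refl_inB hx hk) hτ) hx hk
    (by rw [Equiv.Perm.mul_apply, refl_right hx hk])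
  rwa [refl_mul_cancel hx hk] at this

/-! ### lenB = ell -/

lemma gen_is_refl {n : ℕ} {g : Equiv.Perm ℤ} (hg : g ∈ genB n) :
    ∃ x y, x ∈ signedSet n ∧ y ∈ signedSet n ∧ g = refl' x y := by
  have key : ∀ i : ℤ, 1 ≤ i → i ≤ n → i ∈ signedSet n := fun i h1 h2 =>
    ⟨by omega, by rw [abs_of_nonneg (by omega)]; exact h2⟩
  rcases hg with ⟨i, j, h1, h2, h3, h4, h5, rfl⟩ | ⟨i, j, h1, h2, h3, h4, h5, rfl⟩ |
    ⟨i, h1, h2, rfl⟩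
  · refine ⟨i, j, key i h1 h2, key j h3 h4, ?_⟩
    unfold refl'
    rw [if_neg (by omega), if_neg (by omega)]
  · refine ⟨i, -j, key i h1 h2, neg_mem_signedSet.2 (key j h3 h4), ?_⟩
    unfold refl'
    rw [if_neg (by omega), if_neg (by omega), neg_neg]
  · refine ⟨i, -i, key i h1 h2, neg_mem_signedSet.2 (key i h1 h2), ?_⟩
    unfold refl'
    rw [if_neg (by omega), if_pos rfl]

lemma refl_is_gen {n : ℕ} {x y : ℤ} (hx : x ∈ signedSet n) (hx0 : 0 < x)
    (hy : y ∈ signedSet n) (hxy : y ≠ x) : refl' x y ∈ genB n := by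
  have a1 := (abs_le.1 hx.2)
  have a2 := (abs_le.1 hy.2)
  have a3 := hy.1
  unfold refl'
  rw [if_neg hxy]
  split_ifs with h
  · exact Or.inr (Or.inr ⟨x, by omega, by omega, rfl⟩)
  · by_cases h0 : 0 < y
    · exact Or.inl ⟨x, y, by omega, by omega, by omega, by omega, by omega, rfl⟩
    · exact Or.inr (Or.inl ⟨x, -y, by omega, by omega, by omega, by omega, by omega, by simp⟩)

lemma ell_list_le {n : ℕ} (l : List (Equiv.Perm ℤ)) (h : ∀ g ∈ l, g ∈ genB n) :
    ell n l.prod ≤ l.length := by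
  induction l with
  | nil => simp [ell_one]
  | cons g l ih =>
    rw [List.prod_cons, List.length_cons]
    have h1 := ih fun g hg => h g (List.mem_cons_of_mem _ hg)
    obtain ⟨x, y, hx, hy, e⟩ := gen_is_refl (h g List.mem_cons_self)
    have h2 := ell_refl_le hx hy
    rw [← e] at h2
    have h3 := ell_mul_le n g l.prod
    omega

lemma exists_list {n : ℕ} : ∀ (m : ℕ) (τ : Equiv.Perm ℤ), inB n τ → ell n τ = m →
    ∃ l : List (Equiv.Perm ℤ), l.length = m ∧ (∀ g ∈ l, g ∈ genB n) ∧ l.prod = τ := by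
  intro m
  induction m with
  | zero =>
    intro τ hτ h
    exact ⟨[], rfl, by simp, by simp [eq_one_of_ell hτ h]⟩
  | succ m ih =>
    intro τ hτ h
    have hne : τ ≠ 1 := by rintro rfl; rw [ell_one] at h; omega
    have : ∃ x, τ x ≠ x := by
      by_contra hc
      push Not at hc
      exact hne (Equiv.ext hc)
    obtain ⟨x, hx⟩ := this
    have hxs : x ∈ signedSet n := by
      by_contra hc; exact hx (hτ.2 x hc)
    obtain ⟨y, hys, hy0, hy⟩ : ∃ y ∈ signedSet n, 0 < y ∧ τ y ≠ y := by
      rcases lt_or_gt_of_ne hxs.1 with h0 | h0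
      · exact ⟨-x, neg_mem_signedSet.2 hxs, by omega, by rw [hτ.1]; omega⟩
      · exact ⟨x, hxs, h0, hx⟩
    have hk := inB_mem hτ hys
    have h1 := ell_delete' hτ hys
    rw [if_neg hy] at h1
    obtain ⟨l, hl1, hl2, hl3⟩ := ih (refl' y (τ y) * τ) (inB_mul (refl_inB hys hk) hτ) (by omega)
    refine ⟨refl' y (τ y) :: l, by simp [hl1], ?_, ?_⟩
    · intro g hg
      rcases List.mem_cons.1 hg with rfl | hg
      · exact refl_is_gen hys hy0 hk hy
      · exact hl2 g hg
    · rw [List.prod_cons, hl3, refl_mul_cancel hys hk]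

lemma lenB_eq {n : ℕ} {τ : Equiv.Perm ℤ} (hτ : inB n τ) : lenB n τ = ell n τ := by
  unfold lenB
  apply le_antisymm
  · exact Nat.sInf_le (exists_list _ τ hτ rfl)
  · refine le_csInf ⟨_, exists_list _ τ hτ rfl⟩ ?_
    rintro k ⟨l, rfl, h2, rfl⟩
    exact ell_list_le l h2

/-! ### counting the interval -/

lemma inB_finite (n : ℕ) : {τ : Equiv.Perm ℤ | inB n τ}.Finite := by
  have : Finite (signedSet n) := signedSet_finite n
  let f : {τ : Equiv.Perm ℤ | inB n τ} → (signedSet n → signedSet n) :=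
    fun τ i => ⟨τ.1 i.1, inB_mem τ.2 i.2⟩
  have hf : Function.Injective f := by
    intro a b h
    apply Subtype.ext
    ext x
    by_cases hx : x ∈ signedSet n
    · exact congrArg Subtype.val (congrFun h ⟨x, hx⟩)
    · rw [a.2.2 x hx, b.2.2 x hx]
  exact Set.finite_coe_iff.1 (Finite.of_injective f hf)

def SS (n : ℕ) (γ : Equiv.Perm ℤ) : Set (Equiv.Perm ℤ) :=
  {τ | inB n τ ∧ ell n τ + ell n (τ⁻¹ * γ) = ell n γ}

lemma SS_finite (n : ℕ) (γ : Equiv.Perm ℤ) : (SS n γ).Finite :=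
  (inB_finite n).subset fun _ h => h.1

noncomputable def ff (n : ℕ) (γ : Equiv.Perm ℤ) : ℕ := (SS n γ).ncard

def GG (n : ℕ) (γ : Equiv.Perm ℤ) (x j : ℤ) : Set (Equiv.Perm ℤ) := {τ | τ ∈ SS n γ ∧ τ x = j}

lemma ff_eq_sum {n : ℕ} {γ : Equiv.Perm ℤ} (x : ℤ) (l : List ℤ) (hl : l.Nodup)
    (h : ∀ j, j ∉ l → GG n γ x j = ∅) :
    ff n γ = (l.map fun j => (GG n γ x j).ncard).sum := by
  classical
  unfold ff
  rw [Set.ncard_eq_toFinset_card _ (SS_finite n γ),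
    Finset.card_eq_sum_card_fiberwise (f := fun τ : Equiv.Perm ℤ => τ x) (t := l.toFinset),
    List.sum_toFinset _ hl]
  · congr 1
    apply List.map_congr_left
    intro j _
    rw [← Set.ncard_coe_finset]
    congr 1
    ext τ
    simp [GG]
  · intro τ hτ
    by_contra hc
    have : τ ∈ GG n γ x (τ x) := ⟨by simpa using hτ, rfl⟩
    rw [h (τ x) (by simpa using hc)] at this
    exact this

lemma SS_FF {n : ℕ} {γ τ : Equiv.Perm ℤ} (h : τ ∈ SS n γ) :
    FF n γ ≤ FF n τ ∧ FF n γ ≤ FF n (τ⁻¹ * γ) ∧ FF n τ ⊔ FF n (τ⁻¹ * γ) = VV n := by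
  have := FF_of_le (n := n) (a := τ) (b := τ⁻¹ * γ) (by simpa using h.2)
  simpa using this

lemma GG_empty {n : ℕ} {γ : Equiv.Perm ℤ} {x j : ℤ} {v : ℤ → ℚ} (hv : v ∈ FF n γ)
    (h : v x ≠ v j) : GG n γ x j = ∅ := by
  ext τ
  simp only [Set.mem_empty_iff_false, iff_false]
  rintro ⟨h1, h2⟩
  have := ((SS_FF h1).1 hv).2 x
  rw [h2] at this
  exact h this.symm

lemma SS_fix {n : ℕ} {γ τ : Equiv.Perm ℤ} (hγ : inB n γ) (h : τ ∈ SS n γ) {x : ℤ}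
    (hx : γ x = x) : τ x = x := by
  by_cases hxs : x ∈ signedSet n
  · exact (ee_FF_iff h.1 hxs).1 ((SS_FF h).1 ((ee_FF_iff hγ hxs).2 hx))
  · exact h.1.2 x hxs

lemma SS_one (n : ℕ) : ff n 1 = 1 := by
  have : SS n 1 = {1} := by
    ext τ
    simp only [Set.mem_singleton_iff]
    constructor
    · intro h
      have h2 := h.2
      rw [ell_one] at h2
      exact eq_one_of_ell h.1 (by omega)
    · rintro rfl
      exact ⟨inB_one n, by simp [ell_one]⟩
  unfold ff
  rw [this, Set.ncard_singleton]

/-- key equivalence for deletion of a fixed point -/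
lemma SS_delete {n : ℕ} {δ τ : Equiv.Perm ℤ} (hδ : inB n δ) (hτ : inB n τ) {x k : ℤ}
    (hx : x ∈ signedSet n) (hk : k ∈ signedSet n) (hδx : δ x = x) (hτx : τ x = x) :
    ell n τ + ell n (τ⁻¹ * (refl' x k * δ)) = ell n (refl' x k * δ) ↔
      ell n τ + ell n (τ⁻¹ * δ) = ell n δ := by
  have hτi := inB_inv hτ
  have hτix : τ⁻¹ x = x := by rw [Equiv.Perm.inv_eq_iff_eq, hτx]
  have e : τ⁻¹ * (refl' x k * δ) = refl' x (τ⁻¹ k) * (τ⁻¹ * δ) := by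
    have := refl_conj hτi x k
    rw [hτix] at this
    rw [← this]; group
  rw [e, ell_delete hδ hx hk hδx,
    ell_delete (inB_mul hτi hδ) hx (inB_mem hτi hk) (by rw [Equiv.Perm.mul_apply, hδx, hτix])]
  have : (τ⁻¹ k = x) = (k = x) := by
    rw [Equiv.Perm.inv_eq_iff_eq, hτx]
  simp only [this]
  split_ifs <;> omega

lemma GG_card {n : ℕ} {γ δ : Equiv.Perm ℤ} (hδ : inB n δ) {x j k : ℤ}
    (hx : x ∈ signedSet n) (hj : j ∈ signedSet n) (hk : k ∈ signedSet n) (hδx : δ x = x)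
    (he : refl' x j * γ = refl' x k * δ)
    (hl : ell n (refl' x j * γ) + (if j = x then 0 else 1) = ell n γ) :
    (GG n γ x j).ncard = ff n δ := by
  unfold ff
  refine Set.ncard_congr (fun τ _ => refl' x j * τ) ?_ ?_ ?_
  · rintro τ ⟨⟨h1, h2⟩, h3⟩
    have hB : inB n (refl' x j * τ) := inB_mul (refl_inB hx hj) h1
    have hf : (refl' x j * τ) x = x := by rw [Equiv.Perm.mul_apply, h3, refl_right hx hj]
    refine ⟨hB, ?_⟩
    rw [← SS_delete hδ hB hx hk hδx hf, ← he]
    have h4 := ell_delete' h1 hx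
    rw [h3] at h4
    have h5 : (refl' x j * τ)⁻¹ * (refl' x j * γ) = τ⁻¹ * γ := by group
    rw [h5]
    omega
  · intro a b _ _ h
    exact mul_left_cancel h
  · intro τ' hτ'
    have h1 := hτ'.1
    have hf : τ' x = x := SS_fix hδ hτ' hδx
    have h2 := (SS_delete hδ h1 hx hk hδx hf).2 hτ'.2
    rw [← he] at h2
    refine ⟨refl' x j * τ', ⟨⟨inB_mul (refl_inB hx hj) h1, ?_⟩, ?_⟩, refl_mul_cancel hx hj _⟩
    · have h4 := ell_delete h1 hx hj hf
      have h5 : (refl' x j * τ')⁻¹ * γ = τ'⁻¹ * (refl' x j * γ) := by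
        have : (refl' x j)⁻¹ = refl' x j := inv_eq_of_mul_eq_one_left (refl_mul_self hx hj)
        rw [mul_inv_rev, this, mul_assoc]
      rw [h5]
      omega
    · rw [Equiv.Perm.mul_apply, hf, refl_left hx hj]

/-! ### uniqueness -/

lemma sum_perm {n : ℕ} {γ : Equiv.Perm ℤ} (hγ : inB n γ) (u : ℤ → ℚ) :
    ∑ x ∈ (signedSet_finite n).toFinset, u (γ x) = ∑ x ∈ (signedSet_finite n).toFinset, u x := by
  refine Finset.sum_bij (fun x _ => γ x) ?_ ?_ ?_ ?_
  · intro a ha; simp at ha ⊢; exact inB_mem hγ ha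
  · intro a _ b _ h; exact γ.injective h
  · intro b hb
    simp at hb
    exact ⟨γ⁻¹ b, by simpa using inB_mem (inB_inv hγ) hb, by simp⟩
  · intro _ _; rfl

lemma FF_sigma_le {n : ℕ} {γ τ τ' : Equiv.Perm ℤ} (hγ : inB n γ) (h : τ ∈ SS n γ)
    (h' : τ' ∈ SS n γ) (hF : FF n τ = FF n τ') :
    FF n (τ⁻¹ * γ) ≤ FF n (τ'⁻¹ * γ) := by
  intro w hw
  have hwV : w ∈ FF n τ' ⊔ FF n (τ'⁻¹ * γ) := by rw [(SS_FF h').2.2]; exact hw.1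
  obtain ⟨a, ha, b, hb, rfl⟩ := Submodule.mem_sup.1 hwV
  have haτ : a ∈ FF n τ := hF ▸ ha
  -- general orthogonality
  have orth : ∀ (ρ : Equiv.Perm ℤ), inB n ρ → ∀ w ∈ FF n (ρ⁻¹ * γ), ∀ c ∈ FF n ρ,
      ∑ x ∈ (signedSet_finite n).toFinset, (w (γ⁻¹ x) - w x) * c x = 0 := by
    intro ρ hρ w hw c hc
    have e : ∀ x, w (γ⁻¹ x) = w (ρ⁻¹ x) := by
      intro x
      rw [← hw.2 (γ⁻¹ x)]; simp
    have e2 : ∀ x, c (ρ⁻¹ x) = c x := by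
      intro x
      rw [← hc.2 (ρ⁻¹ x)]; simp
    have := sum_perm (inB_inv hρ) (fun x => w x * c x)
    simp only [e2] at this
    simp only [e, sub_mul, Finset.sum_sub_distrib]
    rw [this, sub_self]
  have o1 := orth τ h.1 (a + b) hw a haτ
  have o2 := orth τ' h'.1 b hb a ha
  have o3 : ∑ x ∈ (signedSet_finite n).toFinset, (a (γ⁻¹ x) - a x) * a x = 0 := by
    have e : ∀ x, (a (γ⁻¹ x) - a x) * a x =
        ((a + b) (γ⁻¹ x) - (a + b) x) * a x - (b (γ⁻¹ x) - b x) * a x := by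
      intro x; simp only [Pi.add_apply]; ring
    simp only [e, Finset.sum_sub_distrib]
    rw [o1, o2, sub_zero]
  have o4 := sum_perm (inB_inv hγ) (fun x => a x * a x)
  have o5 : ∑ x ∈ (signedSet_finite n).toFinset, (a (γ⁻¹ x) - a x) ^ 2 = 0 := by
    have : ∀ x, (a (γ⁻¹ x) - a x) ^ 2 =
        a (γ⁻¹ x) * a (γ⁻¹ x) - a x * a x - 2 * ((a (γ⁻¹ x) - a x) * a x) := by
      intro x; ring
    simp only [this, Finset.sum_sub_distrib, ← Finset.mul_sum]
    rw [o4, o3]; ring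
  rw [Finset.sum_eq_zero_iff_of_nonneg (fun _ _ => sq_nonneg _)] at o5
  have haγ : a ∈ FF n γ := by
    refine ⟨ha.1, fun x => ?_⟩
    by_cases hx : x ∈ signedSet n
    · have := o5 (γ x) (by simpa using inB_mem hγ hx)
      have := pow_eq_zero_iff (two_ne_zero) |>.1 this
      simp at this
      linarith
    · rw [hγ.2 x hx]
  exact Submodule.add_mem _ ((SS_FF h').2.1 haγ) hb

lemma SS_unique {n : ℕ} {γ τ τ' : Equiv.Perm ℤ} (hγ : inB n γ) (h : τ ∈ SS n γ)
    (h' : τ' ∈ SS n γ) (hF : FF n τ = FF n τ') : τ = τ' := by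
  have h1 := FF_sigma_le hγ h h' hF
  rw [← inv_inj]
  refine perm_eq_of_VV (inB_inv h.1) (inB_inv h'.1) fun v hv x => ?_
  rw [← (SS_FF h).2.2] at hv
  obtain ⟨a, ha, b, hb, rfl⟩ := Submodule.mem_sup.1 hv
  have ha' := hF ▸ ha
  have hb' := h1 hb
  have e1 : a (τ⁻¹ x) = a (τ'⁻¹ x) := by
    rw [← ha.2 (τ⁻¹ x), ← ha'.2 (τ'⁻¹ x)]; simp
  have e2 : b (τ⁻¹ x) = b (τ'⁻¹ x) := by
    have c1 := hb.2 (γ⁻¹ x)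
    have c2 := hb'.2 (γ⁻¹ x)
    simp at c1 c2
    exact c1.trans c2.symm
  rw [Pi.add_apply, Pi.add_apply, e1, e2]

lemma FF_pow {n : ℕ} {τ : Equiv.Perm ℤ} {v : ℤ → ℚ} (hv : v ∈ FF n τ) (m : ℤ) (x : ℤ) :
    v ((τ ^ m) x) = v x := by
  induction m using Int.induction_on generalizing x with
  | zero => simp
  | succ i ih => rw [zpow_add, Equiv.Perm.mul_apply, ih, zpow_one, hv.2]
  | pred i ih =>
    rw [zpow_sub, Equiv.Perm.mul_apply, ih, zpow_one]
    rw [← hv.2]; simp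

lemma mem_FF_iff_omega {n : ℕ} {τ : Equiv.Perm ℤ} (hτ : inB n τ) {v : ℤ → ℚ} (hv : v ∈ VV n) :
    v ∈ FF n τ ↔ ∀ A ∈ omegaTilde n τ, ∀ x ∈ A, ∀ y ∈ A, v x = v y := by
  constructor
  · intro h A hA x hx y hy
    rcases hA with ⟨⟨z, hz, rfl⟩, -⟩ | ⟨rfl, -⟩
    · obtain ⟨m, rfl⟩ := hx
      obtain ⟨k, rfl⟩ := hy
      rw [FF_pow h, FF_pow h]
    · have key : ∀ x ∈ ⋃₀ {A | A ∈ orbitsOn n τ ∧ negSet A = A}, v x = 0 := by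
        rintro x ⟨A, ⟨⟨z, hz, rfl⟩, hneg⟩, hx⟩
        have : -x ∈ permOrbit τ z := by
          rw [← hneg]; simpa [negSet] using hx
        obtain ⟨m, hm⟩ := hx
        obtain ⟨k, hk⟩ := this
        have e1 := FF_pow h m z
        have e2 := FF_pow h k z
        rw [hm] at e1
        rw [hk, hv.1] at e2
        linarith
      rw [key x hx, key y hy]
  · intro h
    refine ⟨hv, fun x => ?_⟩
    by_cases hx : x ∈ signedSet n
    · have hO : permOrbit τ x ∈ orbitsOn n τ := ⟨x, hx, rfl⟩
      have h1 : x ∈ permOrbit τ x := ⟨0, by simp⟩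
      have h2 : τ x ∈ permOrbit τ x := ⟨1, by simp⟩
      by_cases hneg : negSet (permOrbit τ x) = permOrbit τ x
      · have hB : permOrbit τ x ⊆ ⋃₀ {A | A ∈ orbitsOn n τ ∧ negSet A = A} :=
          Set.subset_sUnion_of_mem ⟨hO, hneg⟩
        exact h _ (Or.inr ⟨rfl, ⟨x, hB h1⟩⟩) _ (hB h2) _ (hB h1)
      · exact h _ (Or.inl ⟨hO, hneg⟩) _ h2 _ h1
    · rw [hτ.2 x hx]

lemma SncB_eq {p q : ℕ} (hγ : inB (p + q) (gammaPQ p q)) :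
    SncB p q = SS (p + q) (gammaPQ p q) := by
  ext τ
  unfold SncB SS leB
  simp only [Set.mem_ofPred_eq]
  refine and_congr_right fun h => ?_
  rw [lenB_eq h, lenB_eq hγ, lenB_eq (inB_mul (inB_inv h) hγ), eq_comm]

lemma NCB_ncard {p q : ℕ} (hγ : inB (p + q) (gammaPQ p q)) :
    (NCB p q).ncard = ff (p + q) (gammaPQ p q) := by
  have : NCB p q = omegaTilde (p + q) '' SS (p + q) (gammaPQ p q) := by
    rw [← SncB_eq hγ]
    ext π
    simp only [NCB, Set.mem_ofPred_eq, Set.mem_image]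
    constructor
    · rintro ⟨τ, h, rfl⟩; exact ⟨τ, h, rfl⟩
    · rintro ⟨τ, h, rfl⟩; exact ⟨τ, h, rfl⟩
  rw [this, Set.InjOn.ncard_image]
  · rfl
  · intro τ h τ' h' e
    refine SS_unique hγ h h' ?_
    ext v
    constructor
    · intro hv
      rw [mem_FF_iff_omega h'.1 hv.1, ← e, ← mem_FF_iff_omega h.1 hv.1]; exact hv
    · intro hv
      rw [mem_FF_iff_omega h.1 hv.1, e, ← mem_FF_iff_omega h'.1 hv.1]; exact hv

/-! ### cycles given by lists -/

lemma fp_fix {l : List ℤ} {z : ℤ} (h : z ∉ l) : l.formPerm z = z :=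
  List.formPerm_apply_of_notMem h

lemma fp_comm {U V : List ℤ} (h : List.Disjoint U V) :
    U.formPerm * V.formPerm = V.formPerm * U.formPerm := by
  have : Equiv.Perm.Disjoint U.formPerm V.formPerm := by
    intro x
    by_cases hx : x ∈ U
    · exact Or.inr (fp_fix fun hv => h hx hv)
    · exact Or.inl (fp_fix hx)
  exact this.commute.eq

lemma fp_rot {X Y : List ℤ} (h : (X ++ Y).Nodup) : (X ++ Y).formPerm = (Y ++ X).formPerm :=
  List.formPerm_eq_of_isRotated h List.isRotated_append

lemma swap3 {a b u : ℤ} (h1 : a ≠ b) (h2 : a ≠ u) (h3 : u ≠ b) :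
    Equiv.swap a b * (Equiv.swap a u * Equiv.swap u b) = Equiv.swap a u := by
  ext z
  simp only [Equiv.Perm.mul_apply, Equiv.swap_apply_def]
  split_ifs <;> omega

lemma fp_split {a b : ℤ} {U V : List ℤ} (h : (a :: U ++ b :: V).Nodup) :
    Equiv.swap a b * (a :: U ++ b :: V).formPerm = (a :: U).formPerm * (b :: V).formPerm := by
  induction U generalizing a with
  | nil =>
    simp only [List.cons_append, List.nil_append, List.formPerm_cons_cons]
    rw [← mul_assoc, Equiv.swap_mul_self]; simp
  | cons u U ih =>
    have h' : (u :: U ++ b :: V).Nodup := by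
      simp only [List.cons_append] at h ⊢
      exact (List.nodup_cons.1 h).2
    have ih := ih h'
    have hau : a ≠ u := by rintro rfl; simp at h
    have hab : a ≠ b := by rintro rfl; simp at h
    have hub : u ≠ b := by rintro rfl; simp at h'
    have e : (u :: U ++ b :: V).formPerm =
        Equiv.swap u b * ((u :: U).formPerm * (b :: V).formPerm) := by
      rw [← ih, ← mul_assoc, Equiv.swap_mul_self, one_mul]
    have e2 : (a :: (u :: U) ++ b :: V).formPerm =
      Equiv.swap a u * (u :: U ++ b :: V).formPerm := by
      simp only [List.cons_append, List.formPerm_cons_cons]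
    rw [e2, e, List.formPerm_cons_cons]
    calc _ = (Equiv.swap a b * (Equiv.swap a u * Equiv.swap u b)) *
          ((u :: U).formPerm * (b :: V).formPerm) := by group
      _ = _ := by rw [swap3 hab hau hub]; group

lemma fp_join {a b : ℤ} {U V : List ℤ} (h : (a :: U ++ b :: V).Nodup) :
    Equiv.swap a b * ((a :: U).formPerm * (b :: V).formPerm) = (a :: U ++ b :: V).formPerm := by
  rw [← fp_split h, ← mul_assoc, Equiv.swap_mul_self, one_mul]

/-- four-part splitting -/
lemma fp_four {x b x' b' : ℤ} {U V U' V' : List ℤ}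
    (h : ((x :: U ++ b :: V) ++ (x' :: U' ++ b' :: V')).Nodup) :
    Equiv.swap x b * Equiv.swap x' b' * ((x :: U ++ b :: V) ++ (x' :: U' ++ b' :: V')).formPerm =
      (x :: U).formPerm * (x' :: U').formPerm * ((b :: V) ++ (b' :: V')).formPerm := by
  have h1 : ((x' :: U') ++ (b' :: (V' ++ (x :: U ++ b :: V)))).Nodup := by
    refine (List.Perm.nodup_iff ?_).1 h
    rw [List.perm_iff_count]; intro a; simp [List.count_append, List.count_cons]; ring
  have e1 : ((x :: U ++ b :: V) ++ (x' :: U' ++ b' :: V')).formPerm =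
      ((x' :: U') ++ (b' :: (V' ++ (x :: U ++ b :: V)))).formPerm := by
    rw [fp_rot h]; simp
  have h2 : ((b' :: V') ++ (x :: U ++ b :: V)).Nodup := by
    have := (List.nodup_append.1 h1).2.1
    simpa using this
  have e2 : (b' :: (V' ++ (x :: U ++ b :: V))).formPerm =
      ((x :: U) ++ (b :: (V ++ (b' :: V')))).formPerm := by
    have := fp_rot h2
    simpa using this
  have h3 : ((x :: U) ++ (b :: (V ++ (b' :: V')))).Nodup := by
    refine (List.Perm.nodup_iff ?_).1 h2
    rw [List.perm_iff_count]; intro a; simp [List.count_append, List.count_cons]; ring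
  have hc : Equiv.swap x b * (x' :: U').formPerm = (x' :: U').formPerm * Equiv.swap x b := by
    rw [Equiv.mul_swap_eq_swap_mul, fp_fix, fp_fix]
    · intro hb
      exact (List.nodup_append.1 h).2.2 b (by simp) b
        (by simp only [List.mem_append]; exact Or.inl hb) rfl
    · intro hb
      exact (List.nodup_append.1 h).2.2 x (by simp) x
        (by simp only [List.mem_append]; exact Or.inl hb) rfl
  have hc2 : (x' :: U').formPerm * (x :: U).formPerm = (x :: U).formPerm * (x' :: U').formPerm := by
    apply fp_comm
    intro z hz hz'
    exact (List.nodup_append.1 h).2.2 z (by simp only [List.mem_append]; exact Or.inl hz') z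
      (by simp only [List.mem_append]; exact Or.inl hz) rfl
  rw [mul_assoc, e1, fp_split h1, e2, ← mul_assoc, hc, mul_assoc, fp_split h3, ← mul_assoc, hc2]
  simp

def nl (L : List ℤ) : List ℤ := L.map fun x => -x

lemma nl_cons (a : ℤ) (L : List ℤ) : nl (a :: L) = -a :: nl L := rfl
lemma nl_append (A B : List ℤ) : nl (A ++ B) = nl A ++ nl B := List.map_append
lemma nl_nl (L : List ℤ) : nl (nl L) = L := by simp [nl]
lemma nl_nil : nl [] = [] := rfl
lemma nl_length (L : List ℤ) : (nl L).length = L.length := by simp [nl]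
lemma mem_nl {L : List ℤ} {z : ℤ} : z ∈ nl L ↔ -z ∈ L := by
  unfold nl
  rw [List.mem_map]
  constructor
  · rintro ⟨a, h, rfl⟩; simpa using h
  · intro h; exact ⟨-z, h, by simp⟩

def posC (L : List ℤ) : Equiv.Perm ℤ := L.formPerm * (nl L).formPerm
def negC (L : List ℤ) : Equiv.Perm ℤ := (L ++ nl L).formPerm

structure OK (n : ℕ) (L : List ℤ) : Prop where
  nd : (L ++ nl L).Nodup
  mem : ∀ a ∈ L, a ∈ signedSet n

lemma OK.perm {n : ℕ} {L M : List ℤ} (h : OK n L) (hp : L.Perm M) : OK n M := by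
  refine ⟨(List.Perm.nodup_iff (hp.append (hp.map _))).1 h.nd, fun a ha => h.mem a ?_⟩
  exact hp.mem_iff.2 ha

lemma OK.sub {n : ℕ} {L M : List ℤ} (h : OK n L) (hp : M.Sublist L) : OK n M :=
  ⟨h.nd.sublist (hp.append (hp.map _)), fun a ha => h.mem a (hp.subset ha)⟩

lemma OK.flip {n : ℕ} {U V : List ℤ} (h : OK n (U ++ V)) : OK n (nl U ++ V) := by
  refine ⟨?_, fun a ha => ?_⟩
  · refine (List.Perm.nodup_iff ?_).1 h.nd
    rw [List.perm_iff_count]; intro a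
    simp only [nl_append, nl_nl, List.count_append]; ring
  · rw [List.mem_append, mem_nl] at ha
    rcases ha with ha | ha
    · exact neg_mem_signedSet.1 (h.mem (-a) (by simp [ha]))
    · exact h.mem a (by simp [ha])

lemma OK.nl {n : ℕ} {U : List ℤ} (h : OK n U) : OK n (nl U) := by
  have := OK.flip (n := n) (U := U) (V := []) (by simpa using h)
  simpa using this

lemma OK.left {n : ℕ} {U V : List ℤ} (h : OK n (U ++ V)) : OK n U :=
  h.sub (List.sublist_append_left _ _)
lemma OK.right {n : ℕ} {U V : List ℤ} (h : OK n (U ++ V)) : OK n V :=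
  h.sub (List.sublist_append_right _ _)
lemma OK.tail {n : ℕ} {a : ℤ} {V : List ℤ} (h : OK n (a :: V)) : OK n V :=
  h.sub (List.sublist_cons_self _ _)
lemma OK.head {n : ℕ} {a : ℤ} {V : List ℤ} (h : OK n (a :: V)) : a ∈ signedSet n :=
  h.mem a (by simp)

lemma OK.nodup {n : ℕ} {U : List ℤ} (h : OK n U) : U.Nodup := (List.nodup_append.1 h.nd).1
lemma OK.neg_notMem {n : ℕ} {U : List ℤ} (h : OK n U) {a : ℤ} (ha : a ∈ U) : -a ∉ U := by
  intro hc
  exact (List.nodup_append.1 h.nd).2.2 a ha a (mem_nl.2 hc) rfl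

lemma OK.disj {n : ℕ} {U V : List ℤ} (h : OK n (U ++ V)) {a : ℤ} (ha : a ∈ U) :
    a ∉ V ∧ -a ∉ V := by
  constructor
  · intro hc
    exact (List.nodup_append.1 h.nodup).2.2 a ha a hc rfl
  · intro hc
    exact h.neg_notMem (a := a) (by simp [ha]) (by simp [hc])

lemma OK.disj' {n : ℕ} {U V : List ℤ} (h : OK n (U ++ V)) {a : ℤ} (ha : a ∈ V) :
    a ∉ U ∧ -a ∉ U :=
  OK.disj (n := n) (h.perm List.perm_append_comm) ha

lemma posC_fix {L : List ℤ} {z : ℤ} (h : z ∉ L) (h' : -z ∉ L) : posC L z = z := by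
  unfold posC
  rw [Equiv.Perm.mul_apply, fp_fix (l := nl L), fp_fix h]
  rwa [mem_nl]

lemma negC_fix {L : List ℤ} {z : ℤ} (h : z ∉ L) (h' : -z ∉ L) : negC L z = z := by
  unfold negC
  rw [fp_fix]
  simp [mem_nl, h, h']

lemma posC_nil : posC [] = 1 := by simp [posC, nl]
lemma negC_nil : negC [] = 1 := by simp [negC, nl]
lemma posC_single (x : ℤ) : posC [x] = 1 := by simp [posC, nl]

lemma refl_eq {x y : ℤ} (h : y ≠ x) (h' : y ≠ -x) :
    refl' x y = Equiv.swap x y * Equiv.swap (-x) (-y) := by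
  unfold refl'; rw [if_neg h, if_neg h']

lemma refl_symm {x y : ℤ} : refl' x y = refl' y x := by
  unfold refl'
  by_cases h1 : y = x
  · subst h1; rfl
  · rw [if_neg h1, if_neg (Ne.symm h1)]
    by_cases h2 : y = -x
    · subst h2
      simp [Equiv.swap_comm]
    · rw [if_neg h2, if_neg (by omega), Equiv.swap_comm x y, Equiv.swap_comm (-x)]

lemma OK.ne {n : ℕ} {x y : ℤ} {L : List ℤ} (h : OK n (x :: L)) (hy : y ∈ L) : y ≠ x ∧ y ≠ -x := by
  have := OK.disj (n := n) (U := [x]) (V := L) h (a := x) (by simp)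
  constructor
  · rintro rfl; exact this.1 hy
  · rintro rfl; exact this.2 hy

/-- disjointness transported to `nl` -/
lemma OK.comm {n : ℕ} {U V : List ℤ} (h : OK n (U ++ V)) :
    U.formPerm * (_root_.nl V).formPerm = (_root_.nl V).formPerm * U.formPerm := by
  apply fp_comm
  intro z hz hz'
  exact (h.disj hz).2 (mem_nl.1 hz')

lemma OK.comm_self {n : ℕ} {U : List ℤ} (h : OK n U) :
    U.formPerm * (_root_.nl U).formPerm = (_root_.nl U).formPerm * U.formPerm := by
  apply fp_comm
  intro z hz hz'
  exact h.neg_notMem hz (mem_nl.1 hz')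

lemma posC_split {n : ℕ} {x j : ℤ} {U V : List ℤ} (h : OK n (x :: U ++ j :: V)) :
    refl' x j * posC (x :: U ++ j :: V) = posC (x :: U) * posC (j :: V) := by
  have hne := OK.ne (n := n) (x := x) (L := U ++ j :: V) (y := j) (by simpa using h) (by simp)
  rw [refl_eq hne.1 hne.2]
  unfold posC
  have hc : Equiv.swap (-x) (-j) * (x :: U ++ j :: V).formPerm =
      (x :: U ++ j :: V).formPerm * Equiv.swap (-x) (-j) := by
    rw [Equiv.mul_swap_eq_swap_mul, fp_fix (h.neg_notMem (by simp)),
      fp_fix (h.neg_notMem (by simp))]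
  have hn : (nl (x :: U ++ j :: V)).Nodup := (List.nodup_append.1 h.nd).2.1
  have e2 := fp_split (a := -x) (U := nl U) (b := -j) (V := nl V)
    (by simpa [nl_append, nl_cons] using hn)
  have e3 : nl (x :: U ++ j :: V) = -x :: nl U ++ -j :: nl V := by simp [nl_append, nl_cons]
  have hc2 := OK.comm (n := n) (h.perm List.perm_append_comm)
  calc _ = Equiv.swap x j * (Equiv.swap (-x) (-j) * (x :: U ++ j :: V).formPerm) *
        (nl (x :: U ++ j :: V)).formPerm := by group
    _ = (Equiv.swap x j * (x :: U ++ j :: V).formPerm) *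
      (Equiv.swap (-x) (-j) * (nl (x :: U ++ j :: V)).formPerm) := by rw [hc]; group
    _ = (x :: U).formPerm * ((j :: V).formPerm * (nl (x :: U)).formPerm) *
         (nl (j :: V)).formPerm := by
        rw [fp_split h.nodup, e3, e2]; simp only [nl_cons]; group
    _ = _ := by rw [hc2]; group

lemma negC_rot {n : ℕ} {U V : List ℤ} (h : OK n (U ++ V)) : negC (U ++ V) = negC (V ++ nl U) := by
  unfold negC
  have := h.nd
  rw [nl_append] at this ⊢
  rw [List.append_assoc] at this ⊢
  rw [fp_rot this, nl_append, nl_nl]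
  simp

lemma negC_nl {n : ℕ} {U : List ℤ} (h : OK n U) : negC (nl U) = negC U := by
  have := negC_rot (n := n) (U := U) (V := []) (by simpa using h)
  simpa using this.symm

lemma posC_nl {n : ℕ} {U : List ℤ} (h : OK n U) : posC (nl U) = posC U := by
  unfold posC
  rw [nl_nl, h.comm_self]

lemma negC_split {n : ℕ} {x b : ℤ} {U V : List ℤ} (h : OK n (x :: U ++ b :: V)) :
    refl' x b * negC (x :: U ++ b :: V) = posC (x :: U) * negC (b :: V) := by
  have hne := OK.ne (n := n) (x := x) (L := U ++ b :: V) (y := b) (by simpa using h) (by simp)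
  rw [refl_eq hne.1 hne.2]
  have e3 : nl (x :: U ++ b :: V) = -x :: nl U ++ -b :: nl V := by simp [nl_append, nl_cons]
  have hd := h.nd
  unfold posC negC
  rw [e3] at hd ⊢
  rw [fp_four hd]
  rfl

lemma negC_split' {n : ℕ} {x b : ℤ} {U V : List ℤ} (h : OK n (x :: U ++ b :: V)) :
    refl' x (-b) * negC (x :: U ++ b :: V) = posC (b :: V) * negC (x :: U) := by
  have h1 : OK n (-b :: nl V ++ x :: U) := by
    have := OK.flip (n := n) (h.perm List.perm_append_comm)
    simpa [nl_cons] using this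
  have e : negC (x :: U ++ b :: V) = negC (-b :: nl V ++ x :: U) := by
    rw [negC_rot h1]; simp [nl_cons, nl_nl]
  rw [e, refl_symm, negC_split h1, ← nl_cons, posC_nl (n := n) h.right]

lemma negC_pos {n : ℕ} {x : ℤ} {U : List ℤ} (h : OK n (x :: U)) :
    refl' x (-x) * negC (x :: U) = posC (x :: U) := by
  have := h.head.1
  have e : refl' x (-x) = Equiv.swap x (-x) := by
    unfold refl'; rw [if_neg (by omega), if_pos rfl]
  rw [e]
  unfold negC posC
  rw [nl_cons]
  exact fp_split (by simpa [nl_cons] using h.nd)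

lemma negC_join {n : ℕ} {x a : ℤ} {U V : List ℤ} (h : OK n (x :: U ++ a :: V)) :
    refl' x a * (negC (x :: U) * negC (a :: V)) = posC (x :: U ++ nl (a :: V)) := by
  have hne := OK.ne (n := n) (x := x) (L := U ++ a :: V) (y := a) (by simpa using h) (by simp)
  have h0 := hne.1
  have h0' := hne.2
  have hx0 := h.mem x (by simp) |>.1
  have ha0 := h.mem a (by simp) |>.1
  have e0 : refl' x a = Equiv.swap (-x) (-a) * Equiv.swap x a := by
    rw [refl_eq hne.1 hne.2]
    refine (Equiv.Perm.Disjoint.commute (f := Equiv.swap x a) (g := Equiv.swap (-x) (-a)) ?_).eq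
    intro z
    simp only [Equiv.swap_apply_def]
    split_ifs <;> omega
  have hn1 : (x :: (U ++ nl (x :: U)) ++ a :: (V ++ nl (a :: V))).Nodup := by
    refine (List.Perm.nodup_iff ?_).1 h.nd
    rw [List.perm_iff_count]; intro z
    simp [nl_append, nl_cons, List.count_append, List.count_cons]; ring
  have hn2 : ((-x :: (nl U ++ (a :: V))) ++ (-a :: (nl V ++ (x :: U)))).Nodup := by
    refine (List.Perm.nodup_iff ?_).1 h.nd
    rw [List.perm_iff_count]; intro z
    simp [nl_append, nl_cons, List.count_append, List.count_cons]; ring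
  have e1 : Equiv.swap x a * (negC (x :: U) * negC (a :: V)) =
      ((-x :: (nl U ++ (a :: V))) ++ (-a :: (nl V ++ (x :: U)))).formPerm := by
    unfold negC
    have := fp_join hn1
    simp only [List.cons_append] at this ⊢
    rw [this]
    have h2 := fp_rot (X := x :: U) (Y := nl (x :: U) ++ a :: (V ++ nl (a :: V)))
      (by simpa using hn1)
    simp [nl_cons] at h2 ⊢
    rw [h2]
  rw [e0, mul_assoc, e1, fp_split hn2]
  have c : (-x :: (nl U ++ (a :: V))) = nl (x :: U ++ nl (a :: V)) := by
    simp [nl_append, nl_cons, nl_nl]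
  have hok : OK n (x :: U ++ nl (a :: V)) := by
    have := OK.flip (n := n) (h.perm List.perm_append_comm)
    exact this.perm List.perm_append_comm
  have d : (-a :: (nl V ++ (x :: U))).formPerm = (x :: U ++ nl (a :: V)).formPerm := by
    rw [fp_rot hok.nodup]; simp [nl_cons]
  rw [c, d, ← hok.comm_self]
  rfl

lemma posC_del {n : ℕ} {x : ℤ} {U : List ℤ} (h : OK n (x :: U)) :
    ∃ k ∈ signedSet n, posC (x :: U) = refl' x k * posC U ∧ (U ≠ [] → k ≠ x) := by
  cases U with
  | nil => exact ⟨x, h.head, by rw [posC_single, posC_nil, refl_self, one_mul], by simp⟩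
  | cons u U =>
    have hu := h.mem u (by simp)
    refine ⟨u, hu, ?_, fun _ => (h.ne (by simp)).1⟩
    have := posC_split (n := n) (x := x) (U := []) (j := u) (V := U) h
    rw [posC_single, one_mul] at this
    rw [← this, refl_mul_cancel h.head hu]; rfl

lemma negC_del {n : ℕ} {x : ℤ} {U : List ℤ} (h : OK n (x :: U)) :
    ∃ k ∈ signedSet n, negC (x :: U) = refl' x k * negC U ∧ k ≠ x := by
  cases U with
  | nil =>
    have hx := neg_mem_signedSet.2 h.head
    refine ⟨-x, hx, ?_, (signedSet_ne_neg h.head).symm⟩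
    have := negC_pos h
    rw [negC_nil, mul_one, ← refl_mul_cancel h.head hx (negC [x]), this, posC_single, mul_one]
  | cons u U =>
    have hu := h.mem u (by simp)
    refine ⟨u, hu, ?_, (h.ne (by simp)).1⟩
    have := negC_split (n := n) (x := x) (U := []) (b := u) (V := U) h
    rw [posC_single, one_mul] at this
    rw [← this, refl_mul_cancel h.head hu]; rfl

lemma posC_inB {n : ℕ} {U : List ℤ} (h : OK n U) : inB n (posC U) := by
  induction U with
  | nil => rw [posC_nil]; exact inB_one n
  | cons x U ih =>
    obtain ⟨k, hk, e, -⟩ := posC_del h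
    rw [e]; exact inB_mul (refl_inB h.head hk) (ih h.tail)

lemma negC_inB {n : ℕ} {U : List ℤ} (h : OK n U) : inB n (negC U) := by
  induction U with
  | nil => rw [negC_nil]; exact inB_one n
  | cons x U ih =>
    obtain ⟨k, hk, e, -⟩ := negC_del h
    rw [e]; exact inB_mul (refl_inB h.head hk) (ih h.tail)

lemma posC_ell {n : ℕ} {x : ℤ} {U : List ℤ} (h : OK n (x :: U)) {r : Equiv.Perm ℤ} (hr : inB n r)
    (hf : ∀ a ∈ x :: U, r a = a) : ell n (posC (x :: U) * r) = U.length + ell n r := by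
  induction U generalizing x with
  | nil => simp [posC_single]
  | cons u U ih =>
    obtain ⟨k, hk, e, hkx⟩ := posC_del h
    have hkx := hkx (by simp)
    have hfix : (posC (u :: U) * r) x = x := by
      have := OK.disj (n := n) (U := [x]) (V := u :: U) h (a := x) (by simp)
      rw [Equiv.Perm.mul_apply, hf x (by simp), posC_fix this.1 this.2]
    rw [e, mul_assoc, ell_delete (inB_mul (posC_inB h.tail) hr) h.head hk hfix, if_neg hkx,
      ih h.tail (fun a ha => hf a (List.mem_cons_of_mem _ ha)), List.length_cons]
    ring

lemma negC_ell {n : ℕ} {U : List ℤ} (h : OK n U) {r : Equiv.Perm ℤ} (hr : inB n r)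
    (hf : ∀ a ∈ U, r a = a) : ell n (negC U * r) = U.length + ell n r := by
  induction U with
  | nil => simp [negC_nil]
  | cons x U ih =>
    obtain ⟨k, hk, e, hkx⟩ := negC_del h
    have hfix : (negC U * r) x = x := by
      have := OK.disj (n := n) (U := [x]) (V := U) h (a := x) (by simp)
      rw [Equiv.Perm.mul_apply, hf x (by simp), negC_fix this.1 this.2]
    rw [e, mul_assoc, ell_delete (inB_mul (negC_inB h.tail) hr) h.head hk hfix, if_neg hkx,
      ih h.tail (fun a ha => hf a (List.mem_cons_of_mem _ ha)), List.length_cons]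
    ring

/-! ### the recursions -/

lemma sum_split {R : Type*} [AddCommMonoid R] (L : List ℤ) (h : ℤ → R) (c : ℕ → ℕ → R)
    (hc : ∀ U j V, L = U ++ j :: V → h j = c U.length V.length) :
    (L.map h).sum = ∑ i ∈ Finset.range L.length, c i (L.length - 1 - i) := by
  induction L generalizing c with
  | nil => simp
  | cons a L ih =>
    rw [List.map_cons, List.sum_cons, List.length_cons, Finset.sum_range_succ',
      ih (fun i k => c (i + 1) k), hc [] a L rfl, add_comm]
    · simp only [List.length_nil, Nat.add_sub_cancel, Nat.sub_zero]
      congr 1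
      refine Finset.sum_congr rfl fun i hi => ?_
      congr 1
      omega
    · intro U j V e
      have := hc (a :: U) j V (by rw [e]; rfl)
      simpa using this

def vL (L : List ℤ) : ℤ → ℚ := fun z => if z ∈ L then 1 else if -z ∈ L then -1 else 0

lemma posC_mem {n : ℕ} {L : List ℤ} (h : OK n L) (z : ℤ) : posC L z ∈ L ↔ z ∈ L := by
  unfold posC
  rw [Equiv.Perm.mul_apply, List.formPerm_mem_iff_mem]
  by_cases hz : z ∈ nl L
  · have h1 : (nl L).formPerm z ∈ nl L := List.formPerm_apply_mem_of_mem hz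
    rw [mem_nl] at hz h1
    constructor
    · intro h2; exact absurd h1 (h.neg_notMem h2)
    · intro h2; exact absurd hz (h.neg_notMem h2)
  · rw [fp_fix hz]

lemma vL_mem {n : ℕ} {L : List ℤ} (h : OK n L) {r : Equiv.Perm ℤ} (hr : inB n r)
    (hf : ∀ a ∈ L, r a = a) : vL L ∈ FF n (posC L * r) := by
  have hB := inB_mul (posC_inB h) hr
  refine ⟨⟨fun z => ?_, fun z hz => ?_⟩, fun z => ?_⟩
  · unfold vL
    rw [neg_neg]
    by_cases h1 : z ∈ L
    · rw [if_neg (h.neg_notMem h1), if_pos h1, if_pos h1]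
    · by_cases h2 : -z ∈ L
      · rw [if_pos h2, if_neg h1, if_pos h2, neg_neg]
      · rw [if_neg h2, if_neg h1, if_neg h1, if_neg h2, neg_zero]
  · unfold vL
    rw [if_neg, if_neg]
    · intro hc; exact hz (neg_mem_signedSet.1 (h.mem _ hc))
    · intro hc; exact hz (h.mem _ hc)
  · have key : ∀ z, (posC L * r) z ∈ L ↔ z ∈ L := by
      intro z
      rw [Equiv.Perm.mul_apply, posC_mem h]
      constructor
      · intro hc
        have := r.injective (hf _ hc)
        rwa [this] at hc
      · intro hc; rwa [hf z hc]
    unfold vL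
    simp only [← hB.1, key]

lemma fix_of_disj {n : ℕ} {U V : List ℤ} (h : OK n (U ++ V)) {r : Equiv.Perm ℤ}
    (hf : ∀ a ∈ U, r a = a) : ∀ a ∈ U, (posC V * r) a = a := by
  intro a ha
  rw [Equiv.Perm.mul_apply, hf a ha, posC_fix (h.disj ha).1 (h.disj ha).2]

lemma fix_of_disj_neg {n : ℕ} {U V : List ℤ} (h : OK n (U ++ V)) {r : Equiv.Perm ℤ}
    (hf : ∀ a ∈ U, r a = a) : ∀ a ∈ U, (negC V * r) a = a := by
  intro a ha
  rw [Equiv.Perm.mul_apply, hf a ha, negC_fix (h.disj ha).1 (h.disj ha).2]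

lemma ff_pos_aux {n : ℕ} : ∀ (m : ℕ) (L : List ℤ), L.length ≤ m → OK n L →
    ∀ r : Equiv.Perm ℤ, inB n r → (∀ a ∈ L, r a = a) →
    ff n (posC L * r) = catalan L.length * ff n r := by
  intro m
  induction m with
  | zero =>
    intro L hL h r hr hf
    have : L = [] := List.length_eq_zero_iff.1 (by omega)
    subst this
    simp [posC_nil]
  | succ m ih =>
    intro L hL h r hr hf
    cases L with
    | nil => simp [posC_nil]
    | cons x L =>
      rw [List.length_cons] at hL
      have hx := h.head
      rw [ff_eq_sum x (x :: L) h.nodup]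
      · rw [List.map_cons, List.sum_cons,
          sum_split L _ (fun i k => catalan i * (catalan (k + 1) * ff n r))]
        · have e0 : (GG n (posC (x :: L) * r) x x).ncard = catalan L.length * ff n r := by
            rw [← ih L (by omega) h.tail r hr (fun a ha => hf a (List.mem_cons_of_mem _ ha))]
            obtain ⟨k, hk, e, -⟩ := posC_del h
            refine GG_card (k := k) (inB_mul (posC_inB h.tail) hr) hx hx hk ?_ ?_ ?_
            · exact fix_of_disj (n := n) (U := [x]) (V := L) h
                (fun a ha => hf a (by simp at ha; simp [ha])) x (by simp)
            · rw [refl_self, one_mul, e, mul_assoc]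
            · simp [refl_self]
          rw [e0, List.length_cons, catalan_succ, Finset.sum_range (n := L.length)]
          rw [Fin.sum_univ_castSucc]
          simp only [Fin.val_castSucc, Fin.val_last, Nat.sub_self, catalan_zero, mul_one, add_mul,
            Finset.sum_mul]
          rw [add_comm]
          congr 1
          refine Finset.sum_congr rfl fun i _ => ?_
          have hi := i.2
          rw [show L.length - 1 - (i : ℕ) + 1 = L.length - i by omega, mul_assoc]
        · intro U j V e
          subst e
          have hj := h.mem j (by simp)
          have h' : OK n (x :: U ++ j :: V) := by simpa using h
          have hfx : ∀ a ∈ x :: U, r a = a := fun a ha => hf a (by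
            simp at ha ⊢; tauto)
          have hfj : ∀ a ∈ j :: V, r a = a := fun a ha => hf a (by
            simp at ha ⊢; tauto)
          have hr1 : inB n (posC (j :: V) * r) := inB_mul (posC_inB h'.right) hr
          have hf1 := fix_of_disj (n := n) h' hfx
          have hne := (h.ne (y := j) (by simp)).1
          simp only [List.length_append, List.length_cons] at hL
          have i1 := ih U (by omega) h'.left.tail _ hr1
            (fun a ha => hf1 a (List.mem_cons_of_mem _ ha))
          have i2 := ih (j :: V) (by simp; omega) h'.right r hr hfj
          rw [List.length_cons] at i2
          rw [← i2, ← i1]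
          obtain ⟨k, hk, e, -⟩ := posC_del h'.left
          have e1 : refl' x j * (posC (x :: (U ++ j :: V)) * r) =
              posC (x :: U) * (posC (j :: V) * r) := by
            have := posC_split h'
            rw [← mul_assoc, ← mul_assoc, ← this]; rfl
          refine GG_card (k := k) (inB_mul (posC_inB h'.left.tail) hr1) hx hj hk ?_ ?_ ?_
          · have hd := OK.disj (n := n) (U := [x]) (V := U) h'.left (a := x) (by simp)
            rw [Equiv.Perm.mul_apply, hf1 x (by simp), posC_fix hd.1 hd.2]
          · rw [e1, e, mul_assoc]
          · rw [e1, if_neg hne, posC_ell h'.left hr1 hf1, posC_ell h'.right hr hfj,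
              posC_ell h hr hf]
            simp; omega
      · intro j hj
        refine GG_empty (vL_mem h hr hf) ?_
        unfold vL
        rw [if_pos (by simp), if_neg hj]
        split_ifs <;> norm_num

lemma ff_pos {n : ℕ} {L : List ℤ} (h : OK n L) {r : Equiv.Perm ℤ} (hr : inB n r)
    (hf : ∀ a ∈ L, r a = a) : ff n (posC L * r) = catalan L.length * ff n r :=
  ff_pos_aux _ L le_rfl h r hr hf

section neg
variable {n : ℕ} {x : ℤ} {B A : List ℤ}

lemma negC_fixes (h : OK n (B ++ A)) : ∀ a ∈ B, negC A a = a := fun _ ha =>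
  negC_fix (h.disj ha).1 (h.disj ha).2

lemma negC_ell1 (h : OK n A) : ell n (negC A) = A.length := by
  have := negC_ell h (inB_one n) (fun _ _ => rfl)
  simpa [ell_one] using this

lemma gamma_ell (h : OK n (B ++ A)) : ell n (negC B * negC A) = B.length + A.length := by
  rw [negC_ell h.left (negC_inB h.right) (negC_fixes h), negC_ell1 h.right]

lemma case_x (h : OK n (x :: B ++ A)) :
    (GG n (negC (x :: B) * negC A) x x).ncard = ff n (negC B * negC A) := by
  have hx := h.left.head
  obtain ⟨k, hk, e, -⟩ := negC_del h.left
  refine GG_card (k := k) (inB_mul (negC_inB h.left.tail) (negC_inB h.right)) hx hx hk ?_ ?_ ?_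
  · have hd := OK.disj (n := n) (U := [x]) (V := B) h.left (a := x) (by simp)
    rw [Equiv.Perm.mul_apply, negC_fixes h x (by simp), negC_fix hd.1 hd.2]
  · rw [refl_self, one_mul, e, mul_assoc]
  · simp [refl_self]

lemma case_negx (h : OK n (x :: B ++ A)) :
    (GG n (negC (x :: B) * negC A) x (-x)).ncard = catalan B.length * ff n (negC A) := by
  have hx := h.left.head
  have hfix := negC_fixes h
  rw [← ff_pos h.left.tail (negC_inB h.right) (fun a ha => hfix a (List.mem_cons_of_mem _ ha))]
  obtain ⟨k, hk, e, -⟩ := posC_del h.left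
  have e1 : refl' x (-x) * (negC (x :: B) * negC A) = posC (x :: B) * negC A := by
    rw [← mul_assoc, negC_pos h.left]
  refine GG_card (k := k) (inB_mul (posC_inB h.left.tail) (negC_inB h.right)) hx
    (neg_mem_signedSet.2 hx) hk ?_ ?_ ?_
  · have hd := OK.disj (n := n) (U := [x]) (V := B) h.left (a := x) (by simp)
    rw [Equiv.Perm.mul_apply, hfix x (by simp), posC_fix hd.1 hd.2]
  · rw [e1, e, mul_assoc]
  · rw [e1, if_neg (signedSet_ne_neg hx).symm, posC_ell h.left (negC_inB h.right) hfix,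
      gamma_ell h, negC_ell1 h.right]
    simp; omega

lemma case_B {U V : List ℤ} {j : ℤ} (h : OK n (x :: (U ++ j :: V) ++ A)) :
    (GG n (negC (x :: (U ++ j :: V)) * negC A) x j).ncard =
      catalan U.length * ff n (negC (j :: V) * negC A) := by
  have hx := h.left.head
  have hj := h.mem j (by simp)
  have hne := (h.left.ne (y := j) (by simp)).1
  have h1 : OK n (x :: U ++ j :: V) := by simpa using h.left
  have h2 : OK n (x :: U ++ (j :: V ++ A)) := by simpa using h
  have hA := negC_inB h.right
  have hr : inB n (negC (j :: V) * negC A) := inB_mul (negC_inB h1.right) hA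
  have hf : ∀ a ∈ x :: U, (negC (j :: V) * negC A) a = a := by
    refine fix_of_disj_neg (n := n) h1 (fun a ha => negC_fixes h a ?_)
    simp at ha ⊢; tauto
  rw [← ff_pos h1.left.tail hr (fun a ha => hf a (List.mem_cons_of_mem _ ha))]
  obtain ⟨k, hk, e, -⟩ := posC_del h1.left
  have e1 : refl' x j * (negC (x :: (U ++ j :: V)) * negC A) =
      posC (x :: U) * (negC (j :: V) * negC A) := by
    have := negC_split h1
    rw [← mul_assoc, ← mul_assoc, ← this]; rfl
  refine GG_card (k := k) (inB_mul (posC_inB h1.left.tail) hr) hx hj hk ?_ ?_ ?_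
  · have hd := OK.disj (n := n) (U := [x]) (V := U) h1.left (a := x) (by simp)
    rw [Equiv.Perm.mul_apply, hf x (by simp), posC_fix hd.1 hd.2]
  · rw [e1, e, mul_assoc]
  · rw [e1, if_neg hne, posC_ell h1.left hr hf, gamma_ell h, gamma_ell h2.right]
    simp; omega

lemma case_negB {U V : List ℤ} {b : ℤ} (h : OK n (x :: (U ++ b :: V) ++ A)) :
    (GG n (negC (x :: (U ++ b :: V)) * negC A) x (-b)).ncard =
      catalan (V.length + 1) * ff n (negC U * negC A) := by
  have hx := h.left.head
  have hb := h.mem b (by simp)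
  have hne := (h.left.ne (y := b) (by simp)).2
  have h1 : OK n (x :: U ++ b :: V) := by simpa using h.left
  have h2 : OK n (x :: U ++ (b :: V ++ A)) := by simpa using h
  have h3 : OK n ((x :: U ++ A) ++ b :: V) := by
    refine h2.perm ?_
    rw [List.append_assoc]
    exact (List.perm_append_comm).append_left _
  have h4 : OK n (b :: V ++ (x :: U ++ A)) := h3.perm List.perm_append_comm
  have h5 : OK n (b :: V ++ x :: U) := h1.perm List.perm_append_comm
  have hA := negC_inB h.right
  have hfA := negC_fixes h2.right
  have hr : inB n (negC U * negC A) := inB_mul (negC_inB h1.left.tail) hA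
  have hf : ∀ a ∈ b :: V, (negC U * negC A) a = a := by
    intro a ha
    have := h5.disj ha
    simp only [List.mem_cons, not_or] at this
    rw [Equiv.Perm.mul_apply, hfA a ha, negC_fix this.1.2 this.2.2]
  have hf' : ∀ a ∈ b :: V, (negC (x :: U) * negC A) a = a := fix_of_disj_neg (n := n) h5 hfA
  rw [← List.length_cons (a := b), ← ff_pos h1.right hr hf]
  obtain ⟨k, hk, e, -⟩ := negC_del h1.left
  have hdx := h1.disj (a := x) (by simp)
  have hpx : posC (b :: V) x = x := posC_fix hdx.1 hdx.2
  have e1 : refl' x (-b) * (negC (x :: (U ++ b :: V)) * negC A) =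
      posC (b :: V) * (negC (x :: U) * negC A) := by
    have := negC_split' h1
    rw [← mul_assoc, ← mul_assoc, ← this]; rfl
  have hP := posC_inB h1.right
  refine GG_card (k := posC (b :: V) k) (inB_mul hP hr) hx
    (neg_mem_signedSet.2 hb) (inB_mem hP hk) ?_ ?_ ?_
  · have hd := OK.disj (n := n) (U := [x]) (V := U) h1.left (a := x) (by simp)
    rw [Equiv.Perm.mul_apply, Equiv.Perm.mul_apply, negC_fixes h x (by simp),
      negC_fix hd.1 hd.2, hpx]
  · rw [e1, e]
    have := refl_conj hP x k
    rw [hpx] at this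
    rw [← this]; group
  · rw [e1, if_neg (by omega), posC_ell h1.right (inB_mul (negC_inB h1.left) hA) hf',
      gamma_ell h, gamma_ell h3.left]
    simp; omega

lemma case_A {U V : List ℤ} {j : ℤ} (h : OK n (x :: B ++ (U ++ j :: V))) :
    (GG n (negC (x :: B) * negC (U ++ j :: V)) x j).ncard =
      catalan (B.length + (U ++ j :: V).length) := by
  have hx := h.left.head
  have hj := h.mem j (by simp)
  have hne := (OK.ne (n := n) (x := x) (L := B ++ (U ++ j :: V)) (y := j) h (by simp)).1
  have er : negC (U ++ j :: V) = negC (j :: (V ++ nl U)) := by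
    rw [negC_rot h.right]; rfl
  have h1 : OK n (x :: B ++ j :: (V ++ nl U)) := by
    have h2 : OK n (U ++ (j :: V ++ x :: B)) := by
      refine h.perm ?_
      refine List.perm_append_comm.trans ?_
      simp
    refine (OK.flip (n := n) h2).perm ?_
    rw [List.perm_iff_count]; intro z
    simp [List.count_append, List.count_cons]; ring
  set W := j :: (V ++ nl U) with hW
  have hlen : W.length = (U ++ j :: V).length := by
    simp [hW, nl_length]; omega
  have h2 : OK n (x :: B ++ nl W) :=
    (OK.flip (n := n) (h1.perm List.perm_append_comm)).perm List.perm_append_comm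
  have h3 : OK n (x :: (B ++ nl W)) := h2
  obtain ⟨k, hk, e, -⟩ := posC_del h3
  have e1 : refl' x j * (negC (x :: B) * negC (U ++ j :: V)) = posC (x :: (B ++ nl W)) := by
    rw [er]; exact negC_join h1
  have := ff_pos h3.tail (inB_one n) (fun _ _ => rfl)
  rw [SS_one, mul_one, mul_one, List.length_append, nl_length, hlen] at this
  rw [← this]
  refine GG_card (k := k) (posC_inB h3.tail) hx hj hk ?_ ?_ ?_
  · have hd := OK.disj (n := n) (U := [x]) (V := B ++ nl W) h3 (a := x) (by simp)
    rw [posC_fix hd.1 hd.2]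
  · rw [e1, e]
  · rw [e1, if_neg hne, gamma_ell h]
    have := posC_ell h3 (inB_one n) (fun _ _ => rfl)
    rw [mul_one, ell_one, List.length_append, nl_length, hlen] at this
    rw [this]; simp; omega

lemma case_out (h : OK n (x :: B ++ A)) {j : ℤ}
    (hj : j ∉ x :: -x :: (B ++ nl B ++ A ++ nl A)) :
    GG n (negC (x :: B) * negC A) x j = ∅ := by
  have hB := inB_mul (negC_inB h.left) (negC_inB h.right)
  simp only [List.mem_cons, List.mem_append, not_or, mem_nl] at hj
  obtain ⟨h1, h2, ⟨⟨h3, h4⟩, h5⟩, h6⟩ := hj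
  by_cases hs : j ∈ signedSet n
  · have hfix : (negC (x :: B) * negC A) j = j := by
      rw [Equiv.Perm.mul_apply, negC_fix h5 h6, negC_fix]
      · simp [h1, h3]
      · simp [h4]; omega
    refine GG_empty ((ee_FF_iff hB hs).2 hfix) ?_
    rw [ee_self]
    intro hc
    exact h1 (ee_eq_one hc).symm
  · ext τ
    simp only [Set.mem_empty_iff_false, iff_false]
    rintro ⟨hτ, e⟩
    exact hs (e ▸ inB_mem hτ.1 h.left.head)

lemma ff_step {g : ℕ → ℚ} (h : OK n (x :: B ++ A))
    (hg : ∀ C : List ℤ, C.length ≤ B.length → OK n (C ++ A) →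
      (ff n (negC C * negC A) : ℚ) = g C.length) :
    (ff n (negC (x :: B) * negC A) : ℚ) =
      2 * ∑ i ∈ Finset.range (B.length + 1), (catalan i : ℚ) * g (B.length - i) +
        2 * A.length * catalan (B.length + A.length) := by
  have hl : (x :: -x :: (B ++ nl B ++ A ++ nl A)).Nodup := by
    refine (List.Perm.nodup_iff ?_).1 h.nd
    rw [List.perm_iff_count]; intro z
    simp [nl_append, nl_cons, List.count_append, List.count_cons]; ring
  rw [ff_eq_sum x _ hl (fun j hj => case_out h hj)]
  simp only [List.map_cons, List.sum_cons, List.map_append, List.sum_append]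
  have hBA : OK n (B ++ A) := OK.tail (n := n) (a := x) h
  have s1 := hg B le_rfl hBA
  have s2 := hg [] (by simp) (by simpa using h.right)
  rw [negC_nil, one_mul] at s2
  have c1 : ((B.map fun j => (GG n (negC (x :: B) * negC A) x j).ncard).sum : ℚ) =
      ∑ i ∈ Finset.range B.length, (catalan i : ℚ) * g (B.length - 1 - i + 1) := by
    rw [Nat.cast_list_sum, List.map_map]
    apply sum_split B _ (fun i k => (catalan i : ℚ) * g (k + 1))
    intro U j V e
    subst e
    simp only [Function.comp]
    rw [case_B h, Nat.cast_mul, hg (j :: V) (by simp)]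
    · simp
    · refine OK.sub h ?_
      simp only [List.cons_append, List.append_assoc]
      exact ((List.sublist_append_right U _)).cons _
  have c2 : (((nl B).map fun j => (GG n (negC (x :: B) * negC A) x j).ncard).sum : ℚ) =
      ∑ i ∈ Finset.range B.length, (catalan (B.length - 1 - i + 1) : ℚ) * g i := by
    rw [Nat.cast_list_sum, List.map_map, ← nl_length B]
    apply sum_split (nl B) _ (fun i k => (catalan (k + 1) : ℚ) * g i)
    intro U j V e
    have e' : B = nl U ++ -j :: nl V := by
      rw [← nl_nl B, e, nl_append, nl_cons]
    subst e'
    simp only [Function.comp]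
    have := case_negB h
    rw [neg_neg] at this
    rw [this, Nat.cast_mul, hg (nl U) (by simp)]
    · simp [nl_length]
    · refine OK.sub h ?_
      simp only [List.cons_append, List.append_assoc]
      exact (List.Sublist.append_left (((List.sublist_append_right _ _)).cons _) _).cons _
  have c3 : ∀ A', OK n (x :: B ++ A') →
      ((A'.map fun j => (GG n (negC (x :: B) * negC A') x j).ncard).sum : ℚ) =
      A'.length * catalan (B.length + A'.length) := by
    intro A' h'
    rw [Nat.cast_list_sum, List.map_map,
      sum_split A' _ (fun i k => (catalan (B.length + A'.length) : ℚ))]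
    · simp
    · intro U j V e
      subst e
      simp only [Function.comp]
      rw [case_A h']
  have c4 := c3 (nl A) ((OK.flip (n := n) (h.perm List.perm_append_comm)).perm
    List.perm_append_comm)
  rw [negC_nl (n := n) h.right, nl_length] at c4
  push_cast at *
  rw [c1, c2, c3 A h, c4, case_x h, case_negx h, s1]
  push_cast
  rw [s2]
  have d1 : ∑ i ∈ Finset.range (B.length + 1), (catalan i : ℚ) * g (B.length - i) =
      ∑ i ∈ Finset.range B.length, (catalan i : ℚ) * g (B.length - 1 - i + 1) +
        catalan B.length * g 0 := by
    rw [Finset.sum_range_succ, Nat.sub_self]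
    congr 1
    refine Finset.sum_congr rfl fun i hi => ?_
    rw [Finset.mem_range] at hi
    rw [show B.length - 1 - i + 1 = B.length - i by omega]
  have d2 : ∑ i ∈ Finset.range (B.length + 1), (catalan i : ℚ) * g (B.length - i) =
      ∑ i ∈ Finset.range B.length, (catalan (B.length - 1 - i + 1) : ℚ) * g i + g B.length := by
    rw [← Finset.sum_range_reflect, Finset.sum_range_succ]
    congr 1
    · refine Finset.sum_congr rfl fun i hi => ?_
      rw [Finset.mem_range] at hi
      rw [show B.length - 1 - i + 1 = B.length - i by omega,
        show B.length + 1 - 1 - i = B.length - i by omega,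
        show B.length - (B.length - i) = i by omega]
    · simp
  rw [two_mul]
  nth_rewrite 1 [d1]
  rw [d2]
  simp
  ring

end neg

lemma cat_q (m : ℕ) : ((m : ℚ) + 1) * catalan m = Nat.centralBinom m := by
  exact_mod_cast succ_mul_catalan_eq_centralBinom m

lemma cb_q (m : ℕ) : ((m : ℚ) + 1) * Nat.centralBinom (m + 1) =
    2 * (2 * m + 1) * Nat.centralBinom m := by
  exact_mod_cast Nat.succ_mul_centralBinom_succ m

lemma TT (d : ℕ) : ∀ m : ℕ, ∑ j ∈ Finset.range d, 2 * (catalan (m + j) : ℚ) *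
    Nat.centralBinom (d - 1 - j) =
      (d : ℚ) / (m + d) * Nat.centralBinom m * Nat.centralBinom d := by
  induction d with
  | zero => intro m; simp
  | succ d ih =>
    intro m
    rw [Finset.sum_range_succ']
    have e : ∑ k ∈ Finset.range d, 2 * (catalan (m + (k + 1)) : ℚ) *
        Nat.centralBinom (d + 1 - 1 - (k + 1)) = ∑ j ∈ Finset.range d,
          2 * (catalan (m + 1 + j) : ℚ) * Nat.centralBinom (d - 1 - j) := by
      refine Finset.sum_congr rfl fun k _ => ?_
      have e1 : m + (k + 1) = m + 1 + k := by omega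
      have e2 : d + 1 - 1 - (k + 1) = d - 1 - k := by omega
      rw [e1, e2]
    rw [e, ih (m + 1)]
    simp only [Nat.add_sub_cancel, add_zero, Nat.sub_zero]
    have h1 : (catalan m : ℚ) = Nat.centralBinom m / (m + 1) := by
      rw [← cat_q]; field_simp
    have h2 : (Nat.centralBinom (m + 1) : ℚ) =
        2 * (2 * m + 1) * Nat.centralBinom m / (m + 1) := by
      rw [← cb_q]; field_simp
    have h3 : (Nat.centralBinom (d + 1) : ℚ) =
        2 * (2 * d + 1) * Nat.centralBinom d / (d + 1) := by
      rw [← cb_q]; field_simp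
    rw [h1, h2, h3]
    push_cast
    have : (m : ℚ) + 1 + d ≠ 0 := by positivity
    have : (m : ℚ) + (d + 1) ≠ 0 := by positivity
    field_simp
    ring

lemma cb_rec (b : ℕ) : (Nat.centralBinom (b + 1) : ℚ) =
    2 * ∑ i ∈ Finset.range (b + 1), (catalan i : ℚ) * Nat.centralBinom (b - i) := by
  have := TT (b + 1) 0
  rw [Finset.mul_sum]
  simp only [zero_add, Nat.add_sub_cancel, Nat.centralBinom_zero, Nat.cast_one, Nat.cast_zero,
    mul_one] at this
  rw [div_self (by positivity), one_mul] at this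
  rw [← this]
  exact Finset.sum_congr rfl fun _ _ => by ring

def KK (a b : ℕ) : ℚ := (a : ℚ) * b / (a + b) * Nat.centralBinom a * Nat.centralBinom b

lemma KK_eq (a b : ℕ) : KK a b = 2 * a * ∑ j ∈ Finset.range b, (catalan (a + j) : ℚ) *
    Nat.centralBinom (b - 1 - j) := by
  have := TT b a
  have e : ∑ j ∈ Finset.range b, 2 * (catalan (a + j) : ℚ) * Nat.centralBinom (b - 1 - j) =
      2 * ∑ j ∈ Finset.range b, (catalan (a + j) : ℚ) * Nat.centralBinom (b - 1 - j) := by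
    rw [Finset.mul_sum]
    exact Finset.sum_congr rfl fun _ _ => by ring
  rw [e] at this
  unfold KK
  linear_combination (-(a : ℚ)) * this

lemma KK_rec (a m : ℕ) : KK a (m + 1) =
    2 * ∑ i ∈ Finset.range (m + 1), (catalan i : ℚ) * KK a (m - i) +
      2 * a * catalan (m + a) := by
  rw [KK_eq, Finset.sum_range_succ, Finset.sum_range_succ (fun i => (catalan i : ℚ) * KK a (m - i))]
  have z : KK a (m - m) = 0 := by simp [KK]
  rw [z]
  simp only [Nat.add_sub_cancel, Nat.sub_self, Nat.centralBinom_zero, Nat.cast_one, mul_one,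
    mul_zero, add_zero]
  have e1 : ∑ j ∈ Finset.range m, (catalan (a + j) : ℚ) * Nat.centralBinom (m - j) =
      ∑ j ∈ Finset.range m, ∑ i ∈ Finset.range (m - j), 2 * ((catalan (a + j) : ℚ) *
        catalan i * Nat.centralBinom (m - 1 - j - i)) := by
    refine Finset.sum_congr rfl fun j hj => ?_
    rw [Finset.mem_range] at hj
    have e : m - j = (m - 1 - j) + 1 := by omega
    rw [e, cb_rec, Finset.mul_sum, Finset.mul_sum]
    exact Finset.sum_congr rfl fun _ _ => by ring
  have e2 : ∑ i ∈ Finset.range m, (catalan i : ℚ) * KK a (m - i) =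
      a * ∑ i ∈ Finset.range m, ∑ j ∈ Finset.range (m - i), 2 * ((catalan (a + j) : ℚ) *
        catalan i * Nat.centralBinom (m - 1 - j - i)) := by
    rw [Finset.mul_sum]
    refine Finset.sum_congr rfl fun i hi => ?_
    rw [KK_eq, Finset.mul_sum, Finset.mul_sum, Finset.mul_sum]
    refine Finset.sum_congr rfl fun j hj => ?_
    have e : m - i - 1 - j = m - 1 - j - i := by omega
    rw [e]; ring
  rw [e1, e2, Finset.sum_comm' (t' := Finset.range m) (s' := fun i => Finset.range (m - i))
    (by intro x y; simp only [Finset.mem_range]; omega), add_comm m a]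
  ring

def MM (a b : ℕ) : ℚ := (Nat.centralBinom a : ℚ) * Nat.centralBinom b + KK a b

lemma MM_rec (a m : ℕ) : MM a (m + 1) =
    2 * ∑ i ∈ Finset.range (m + 1), (catalan i : ℚ) * MM a (m - i) +
      2 * a * catalan (m + a) := by
  unfold MM
  rw [KK_rec, cb_rec]
  simp only [mul_add, Finset.sum_add_distrib, Finset.mul_sum]
  rw [← add_assoc]
  congr 2
  exact Finset.sum_congr rfl fun _ _ => by ring

lemma ff_ind {n : ℕ} {A : List ℤ} (h0 : (ff n (negC A) : ℚ) = MM A.length 0) (k : ℕ) :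
    ∀ B : List ℤ, B.length ≤ k → OK n (B ++ A) →
      (ff n (negC B * negC A) : ℚ) = MM A.length B.length := by
  induction k with
  | zero =>
    intro B hB _
    have : B = [] := List.length_eq_zero_iff.1 (by omega)
    subst this
    rw [negC_nil, one_mul, h0]; rfl
  | succ k ih =>
    intro B hB h
    cases B with
    | nil => rw [negC_nil, one_mul, h0]; rfl
    | cons x B =>
      rw [ff_step (g := MM A.length) h fun C hC hO => ih C (by simp at hB; omega) hO]
      rw [List.length_cons, MM_rec]

lemma ff_negC {n : ℕ} {A : List ℤ} (h : OK n A) : (ff n (negC A) : ℚ) = MM A.length 0 := by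
  have := ff_ind (n := n) (A := []) (by rw [negC_nil, SS_one]; simp [MM, KK]) A.length A le_rfl
    (by simpa using h)
  rw [negC_nil, mul_one] at this
  rw [this]; simp [MM, KK]

lemma ff_two {n : ℕ} {A B : List ℤ} (h : OK n (B ++ A)) :
    (ff n (negC B * negC A) : ℚ) = MM A.length B.length :=
  ff_ind (ff_negC h.right) _ B le_rfl h

def L1 (p : ℕ) : List ℤ := (List.range p).map fun i : ℕ => ((i : ℤ) + 1)
def L2 (p q : ℕ) : List ℤ := (List.range q).map fun i : ℕ => ((p : ℤ) + (i : ℤ) + 1)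

lemma gamma_eq (p q : ℕ) : gammaPQ p q = negC (L1 p) * negC (L2 p q) := by
  have e : ∀ (l : List ℕ), (do let a ← l; pure (a : ℤ)) = l.map (fun i : ℕ => (i : ℤ)) := by
    intro l; simp [List.map_eq_flatMap]
  simp only [gammaPQ, negC, nl, L1, L2, e, List.map_map, Function.comp_def]

lemma L_OK (p q : ℕ) : OK (p + q) (L1 p ++ L2 p q) := by
  have hpos : ∀ a ∈ L1 p ++ L2 p q, 0 < a ∧ a ≤ (p : ℤ) + q := by
    intro a ha
    simp only [L1, L2, List.mem_append, List.mem_map, List.mem_range] at ha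
    rcases ha with ⟨i, hi, rfl⟩ | ⟨i, hi, rfl⟩ <;> omega
  have hnd : (L1 p ++ L2 p q).Nodup := by
    rw [List.nodup_append]
    refine ⟨List.nodup_range.map fun i j h => by simpa using h,
      List.nodup_range.map fun i j h => by simpa using h, ?_⟩
    intro a ha b hb
    simp only [L1, L2, List.mem_map, List.mem_range] at ha hb
    obtain ⟨i, hi, rfl⟩ := ha
    obtain ⟨j, hj, rfl⟩ := hb
    omega
  refine ⟨?_, fun a ha => ?_⟩
  · rw [List.nodup_append]
    refine ⟨hnd, hnd.map neg_injective, ?_⟩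
    intro a ha b hb
    have h1 := hpos a ha
    have h2 := hpos _ (mem_nl.1 hb)
    omega
  · have h1 := hpos a ha
    refine ⟨by omega, ?_⟩
    rw [abs_le]; push_cast; omega

/-- The total number of partitions in `NC^B(p,q)` equals
`((p+q+pq)/(p+q))·C(2p,p)·C(2q,q)`. -/
theorem ncb_total_card (p q : ℕ) (hp : 1 ≤ p) (hq : 1 ≤ q) :
    ((NCB p q).ncard : ℚ) =
      (((p : ℚ) + q + p * q) / ((p : ℚ) + q)) *
        (Nat.choose (2 * p) p : ℚ) * (Nat.choose (2 * q) q : ℚ) := by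
  have hO := L_OK p q
  have hγ : inB (p + q) (gammaPQ p q) := by
    rw [gamma_eq]; exact inB_mul (negC_inB hO.left) (negC_inB hO.right)
  rw [NCB_ncard hγ, gamma_eq, ff_two hO]
  have l1 : (L1 p).length = p := by simp [L1]
  have l2 : (L2 p q).length = q := by simp [L2]
  rw [l1, l2, MM, KK, Nat.centralBinom, Nat.centralBinom]
  have : (p : ℚ) + q ≠ 0 := by positivity
  have : (q : ℚ) + p ≠ 0 := by positivity
  field_simp
  ring
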